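/- arXiv:2402.06740 — 12 statements merged into one kernel-verified Lean document; each statement's English description precedes it below -/
import Mathlib

section
/- If f : {0,1}^n → {0,1} (n ≥ 1) has a Hamming nearest neighbor (HNN) representation with m anchors, then f has a min-plus polynomial threshold function (mpPTF) representation with m terms and maximum weight at most n. -/
/-- A Hamming nearest neighbor (HNN) representation of a Boolean function `f`:
all anchors are Boolean vectors and distances are Hamming distances. -/
def IsHNNRep {n : ℕ} (f : (Fin n → Bool) → Bool) (P N : Finset (Fin n → Bool)) : Prop :=
  P.Nonempty ∧ N.Nonempty ∧ Disjoint P N ∧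
    ∀ x : Fin n → Bool,
      (f x = true ↔ ∃ p ∈ P, ∀ q ∈ N, hammingDist x p < hammingDist x q) ∧
      (f x = false ↔ ∃ q ∈ N, ∀ p ∈ P, hammingDist x q < hammingDist x p)

/-- Value of an affine form with integer coefficients at a Boolean point. -/
def evalZ {n : ℕ} (L : (Fin n → ℤ) × ℤ) (x : Fin n → Bool) : ℤ :=
  (∑ i, L.1 i * (if x i then 1 else 0)) + L.2

/-- The affine form whose value at a Boolean point is its Hamming distance to `p`. -/
def hammingForm {n : ℕ} (p : Fin n → Bool) : (Fin n → ℤ) × ℤ :=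
  (fun i => if p i then -1 else 1, ∑ i, if p i then 1 else 0)

theorem evalZ_hammingForm {n : ℕ} (p x : Fin n → Bool) :
    evalZ (hammingForm p) x = hammingDist x p := by
  simp only [evalZ, hammingForm, hammingDist, Finset.card_filter, Nat.cast_sum]
  rw [← Finset.sum_add_distrib]
  refine Finset.sum_congr rfl fun i _ => ?_
  cases p i <;> cases x i <;> simp

theorem abs_hammingForm_coeff_le {n : ℕ} (hn : 1 ≤ n) (p : Fin n → Bool) (i : Fin n) :
    |(hammingForm p).1 i| ≤ (n : ℤ) := by
  have h : |(hammingForm p).1 i| = 1 := by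
    cases hp : p i <;> simp [hammingForm, hp]
  omega

theorem abs_hammingForm_const_le {n : ℕ} (p : Fin n → Bool) :
    |(hammingForm p).2| ≤ (n : ℤ) := by
  have h : (hammingForm p).2 = ((Finset.univ.filter fun i => p i = true).card : ℤ) := by
    simp [hammingForm]
  rw [h, Nat.abs_cast]
  exact_mod_cast (Finset.card_le_univ _).trans_eq (Fintype.card_fin n)

/-- The elements of a nonempty finite set can be listed by some `Fin (a + 1)`. -/
theorem Finset.Nonempty.exists_equiv_fin_succ {α : Type*} {s : Finset α} (hs : s.Nonempty) :
    ∃ a : ℕ, s.card = a + 1 ∧ Nonempty (Fin (a + 1) ≃ s) := by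
  obtain ⟨a, ha⟩ := Nat.exists_eq_succ_of_ne_zero hs.card_ne_zero
  exact ⟨a, ha, ⟨(s.equivFinOfCardEq ha).symm⟩⟩

/-- an HNN representation with `m` anchors yields an mpPTF
representation with `m` terms and maximum weight at most `n`. -/
theorem statement_1 {n : ℕ} (hn : 1 ≤ n) (f : (Fin n → Bool) → Bool)
    (P N : Finset (Fin n → Bool)) (m : ℕ) (hm : P.card + N.card = m)
    (hrep : IsHNNRep f P N) :
    ∃ (a b : ℕ) (L : Fin (a + 1) → (Fin n → ℤ) × ℤ) (R : Fin (b + 1) → (Fin n → ℤ) × ℤ),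
      (a + 1) + (b + 1) = m ∧
      (∀ i j, |(L i).1 j| ≤ (n : ℤ)) ∧ (∀ i, |(L i).2| ≤ (n : ℤ)) ∧
      (∀ i j, |(R i).1 j| ≤ (n : ℤ)) ∧ (∀ i, |(R i).2| ≤ (n : ℤ)) ∧
      ∀ x : Fin n → Bool,
        (f x = true ↔
          Finset.univ.inf' Finset.univ_nonempty (fun i => evalZ (L i) x) ≤
            Finset.univ.inf' Finset.univ_nonempty (fun j => evalZ (R j) x)) := by
  obtain ⟨hP, hN, -, hf⟩ := hrep
  obtain ⟨a, ha, ⟨eP⟩⟩ := hP.exists_equiv_fin_succ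
  obtain ⟨b, hb, ⟨eN⟩⟩ := hN.exists_equiv_fin_succ
  refine ⟨a, b, fun i => hammingForm (eP i), fun j => hammingForm (eN j), by omega,
    fun i => abs_hammingForm_coeff_le hn _, fun i => abs_hammingForm_const_le _,
    fun i => abs_hammingForm_coeff_le hn _, fun i => abs_hammingForm_const_le _, fun x => ?_⟩
  simp only [evalZ_hammingForm]
  constructor
  · intro hx
    obtain ⟨p, hp, hlt⟩ := (hf x).1.mp hx
    refine Finset.le_inf' _ _ fun j _ => ?_
    refine (Finset.inf'_le _ (Finset.mem_univ (eP.symm ⟨p, hp⟩))).trans ?_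
    rw [Equiv.apply_symm_apply]
    exact_mod_cast (hlt _ (eN j).2).le
  · contrapose!
    intro hx
    obtain ⟨q, hq, hlt⟩ := (hf x).2.mp (Bool.eq_false_of_not_eq_true hx)
    refine (Finset.inf'_le _ (Finset.mem_univ (eN.symm ⟨q, hq⟩))).trans_lt ?_
    rw [Equiv.apply_symm_apply, Finset.lt_inf'_iff]
    exact fun i _ => by exact_mod_cast hlt _ (eP i).2
end

section
/- If f : {0,1}^n → {0,1} has a min-plus polynomial threshold function (mpPTF) representation with m terms, then there exist nonempty disjoint finite sets P, N ⊆ ℝ^{n+1} with |P| + |N| ≤ m such that for every x ∈ {0,1}^n, writing x' = (x, 1) ∈ ℝ^{n+1}: if f(x) = 1 then some p ∈ P satisfies ‖x' − p‖² < ‖x' − q‖² for every q ∈ N, and if f(x) = 0 then some q ∈ N satisfies ‖x' − q‖² < ‖x' − p‖² for every p ∈ P. That is, f is obtained from a function with an NN representation with at most m anchors in n + 1 dimensions by fixing the extra coordinate to 1. -/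
/-- Embed a Boolean vector into `ℝ^n`. -/
def bv {n : ℕ} (x : Fin n → Bool) : Fin n → ℝ := fun i => if x i then 1 else 0

/-- Squared Euclidean distance on `ℝ^n`. -/
def sqDist {n : ℕ} (u v : Fin n → ℝ) : ℝ := ∑ i, (u i - v i) ^ 2

/-- With query points `(x, 1)`, an affine form shifted by a large enough constant is,
up to `‖x‖²`, the squared distance to a suitable anchor. -/
lemma exists_anchor {n : ℕ} (L : (Fin n → ℤ) × ℤ) (K : ℝ)
    (hK : ∑ i, (L.1 i : ℝ) ^ 2 - 2 * L.2 ≤ K) :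
    ∃ p : Fin (n + 1) → ℝ, ∀ x : Fin n → Bool,
      sqDist (Fin.snoc (bv x) 1) p = ∑ i, bv x i ^ 2 + 2 * (evalZ L x : ℝ) + K := by
  refine ⟨Fin.snoc (fun i => -(L.1 i : ℝ))
    (1 - √(K - (∑ i, (L.1 i : ℝ) ^ 2 - 2 * L.2))), fun x => ?_⟩
  have hsq := Real.sq_sqrt (sub_nonneg.2 hK)
  have hsum : ∑ i, (bv x i - -(L.1 i : ℝ)) ^ 2
      = ∑ i, bv x i ^ 2 + 2 * ∑ i, (L.1 i : ℝ) * bv x i + ∑ i, (L.1 i : ℝ) ^ 2 := by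
    rw [Finset.mul_sum, ← Finset.sum_add_distrib, ← Finset.sum_add_distrib]
    exact Finset.sum_congr rfl fun i _ => by ring
  have heval : (evalZ L x : ℝ) = ∑ i, (L.1 i : ℝ) * bv x i + L.2 := by
    simp [evalZ, bv]
  simp only [sqDist, Fin.sum_univ_castSucc, Fin.snoc_castSucc, Fin.snoc_last, sub_sub_cancel]
  rw [hsum, hsq, heval]
  ring

/-- an mpPTF representation with `m` terms yields an NN representation
with at most `m` anchors in `n+1` dimensions, where the query point is `(x, 1)`. -/
theorem statement_2 {n : ℕ} (f : (Fin n → Bool) → Bool) (m : ℕ)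
    (a b : ℕ) (L : Fin (a + 1) → (Fin n → ℤ) × ℤ) (R : Fin (b + 1) → (Fin n → ℤ) × ℤ)
    (hm : (a + 1) + (b + 1) = m)
    (hrep : ∀ x : Fin n → Bool,
      (f x = true ↔
        Finset.univ.inf' Finset.univ_nonempty (fun i => evalZ (L i) x) ≤
          Finset.univ.inf' Finset.univ_nonempty (fun j => evalZ (R j) x))) :
    ∃ P N : Finset (Fin (n + 1) → ℝ),
      P.Nonempty ∧ N.Nonempty ∧ Disjoint P N ∧ P.card + N.card ≤ m ∧
      ∀ x : Fin n → Bool,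
        (f x = true →
          ∃ p ∈ P, ∀ q ∈ N, sqDist (Fin.snoc (bv x) 1) p < sqDist (Fin.snoc (bv x) 1) q) ∧
        (f x = false →
          ∃ q ∈ N, ∀ p ∈ P, sqDist (Fin.snoc (bv x) 1) q < sqDist (Fin.snoc (bv x) 1) p) := by
  classical
  obtain ⟨A, hA⟩ := (Set.finite_range fun i =>
    ∑ k, ((L i).1 k : ℝ) ^ 2 - 2 * (L i).2).bddAbove
  obtain ⟨B, hB⟩ := (Set.finite_range fun j =>
    ∑ k, ((R j).1 k : ℝ) ^ 2 - 2 * (R j).2).bddAbove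
  -- Since the forms are integral, shifting the `L` side by a further `-1` breaks ties towards it.
  choose p hp using fun i => exists_anchor (L i) (max (A + 1) B - 1)
    (by linarith [hA ⟨i, rfl⟩, le_max_left (A + 1) B])
  choose q hq using fun j => exists_anchor (R j) (max (A + 1) B)
    (by linarith [hB ⟨j, rfl⟩, le_max_right (A + 1) B])
  have hlt (x i j) : sqDist (Fin.snoc (bv x) 1) (p i) < sqDist (Fin.snoc (bv x) 1) (q j) ↔
      evalZ (L i) x ≤ evalZ (R j) x := by
    rw [hp, hq, show evalZ (L i) x ≤ evalZ (R j) x ↔ 2 * evalZ (L i) x - 1 < 2 * evalZ (R j) x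
      by omega, ← Int.cast_lt (R := ℝ)]
    push_cast
    constructor <;> intro h <;> linarith
  have hgt (x i j) : sqDist (Fin.snoc (bv x) 1) (q j) < sqDist (Fin.snoc (bv x) 1) (p i) ↔
      evalZ (R j) x < evalZ (L i) x := by
    rw [hp, hq, show evalZ (R j) x < evalZ (L i) x ↔ 2 * evalZ (R j) x < 2 * evalZ (L i) x - 1
      by omega, ← Int.cast_lt (R := ℝ)]
    push_cast
    constructor <;> intro h <;> linarith
  refine ⟨Finset.univ.image p, Finset.univ.image q, by simp, by simp, ?_, ?_, fun x => ⟨?_, ?_⟩⟩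
  · simp only [Finset.disjoint_left, Finset.mem_image, Finset.mem_univ, true_and]
    rintro _ ⟨i, rfl⟩ ⟨j, hij⟩
    have h₁ := hlt (fun _ => false) i j
    have h₂ := hgt (fun _ => false) i j
    rw [hij] at h₁ h₂
    simp only [lt_self_iff_false, false_iff] at h₁ h₂
    omega
  · rw [← hm]
    exact add_le_add (Finset.card_image_le.trans_eq (by simp))
      (Finset.card_image_le.trans_eq (by simp))
  · intro hf
    obtain ⟨i, -, hi⟩ := Finset.exists_mem_eq_inf' Finset.univ_nonempty fun i => evalZ (L i) x
    refine ⟨p i, by simp, ?_⟩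
    simp only [Finset.mem_image, Finset.mem_univ, true_and, forall_exists_index,
      forall_apply_eq_imp_iff, hlt]
    intro j
    have h := (hrep x).1 hf
    rw [hi] at h
    exact h.trans (Finset.inf'_le _ (Finset.mem_univ j))
  · intro hf
    obtain ⟨j, -, hj⟩ := Finset.exists_mem_eq_inf' Finset.univ_nonempty fun j => evalZ (R j) x
    refine ⟨q j, by simp, ?_⟩
    simp only [Finset.mem_image, Finset.mem_univ, true_and, forall_exists_index,
      forall_apply_eq_imp_iff, hgt]
    intro i
    have h := not_le.1 (mt (hrep x).2 (by simp [hf]))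
    rw [hj] at h
    exact h.trans_le (Finset.inf'_le _ (Finset.mem_univ i))
end

section
/- If f : {0,1}^n → {0,1} (n ≥ 1) has a min-plus polynomial threshold function (mpPTF) representation with m terms and maximum weight W ≥ 1, then there exist a dimension ñ ≤ 16(n+1)W, a map v : {0,1}^n → {0,1}^{ñ} each of whose output coordinates is either one of the input variables x_1, …, x_n or a constant 0 or 1, and nonempty disjoint sets P, N ⊆ {0,1}^{ñ} with |P| + |N| ≤ m, such that for every x ∈ {0,1}^n: if f(x) = 1 then some p ∈ P is strictly closer to v(x) in Hamming distance than every q ∈ N, and if f(x) = 0 then some q ∈ N is strictly closer to v(x) in Hamming distance than every p ∈ P. -/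
/-- The coordinate substitution: `2 * W` copies of every input variable, followed by `M` zeros. -/
def copySubst (n W M : ℕ) : (Fin n × Fin (2 * W)) ⊕ Fin M → Fin n ⊕ Bool :=
  Sum.elim (fun p => Sum.inl p.1) (fun _ => Sum.inr false)

/-- The unary encoding of an affine form: block `i` has `W - w i` ones and the constant block
has `u` ones. -/
def anchor {n : ℕ} (W M : ℕ) (w : Fin n → ℤ) (u : ℤ) : (Fin n × Fin (2 * W)) ⊕ Fin M → Bool :=
  Sum.elim (fun p => decide ((p.2 : ℤ) < W - w p.1)) (fun k => decide ((k : ℤ) < u))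

/-- The number of ones in the constant block of the anchor whose distance encodes `2 * L + d`. -/
def offset {n : ℕ} (W : ℕ) (L : (Fin n → ℤ) × ℤ) (d : ℤ) : ℤ :=
  2 * L.2 + ∑ i, L.1 i + d + (n + 2) * W

theorem card_fin_lt (K : ℕ) (t : ℤ) (h0 : 0 ≤ t) (hK : t ≤ K) :
    (∑ k : Fin K, if (k : ℤ) < t then (1 : ℤ) else 0) = t := by
  lift t to ℕ using h0
  have htK : t ≤ K := by exact_mod_cast hK
  rw [Fin.sum_univ_eq_sum_range (fun k : ℕ => if (k : ℤ) < t then (1 : ℤ) else 0) K,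
    Finset.sum_ite, Finset.sum_const_zero, add_zero, Finset.sum_const, nsmul_eq_mul, mul_one]
  have : (Finset.range K).filter (fun k : ℕ => (k : ℤ) < t) = Finset.range t := by
    ext k
    simp only [Finset.mem_filter, Finset.mem_range, Nat.cast_lt]
    omega
  rw [this, Finset.card_range]

theorem hammingDist_eq_sum {ι : Type*} [Fintype ι] (g h : ι → Bool) :
    (hammingDist g h : ℤ) = ∑ i, if g i ≠ h i then (1 : ℤ) else 0 := by
  simp only [hammingDist, Finset.sum_boole]

theorem hammingDist_comp_equiv {ι κ : Type*} [Fintype ι] [Fintype κ] (e : κ ≃ ι) (g h : ι → Bool) :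
    hammingDist (g ∘ e) (h ∘ e) = hammingDist g h := by
  have := Equiv.sum_comp e (fun i => if g i ≠ h i then (1 : ℤ) else 0)
  zify
  rw [hammingDist_eq_sum, hammingDist_eq_sum, ← this]
  rfl

theorem hammingDist_anchor {n W M : ℕ} (w : Fin n → ℤ) (u : ℤ) (hw : ∀ i, |w i| ≤ (W : ℤ))
    (h0 : 0 ≤ u) (hM : u ≤ M) (x : Fin n → Bool) :
    (hammingDist (fun i => Sum.elim x id (copySubst n W M i)) (anchor W M w u) : ℤ) =
      ∑ i, (W - w i + 2 * (w i * (if x i then 1 else 0))) + u := by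
  rw [hammingDist_eq_sum, Fintype.sum_sum_type, Fintype.sum_prod_type]
  congr 1
  · refine Finset.sum_congr rfl fun i _ => ?_
    have hi := abs_le.mp (hw i)
    have hc := card_fin_lt (2 * W) (W - w i) (by linarith) (by push_cast; linarith)
    cases hx : x i
    · rw [if_neg Bool.false_ne_true, mul_zero, mul_zero, add_zero]
      conv_rhs => rw [← hc]
      refine Finset.sum_congr rfl fun k _ => ?_
      by_cases hk : (k : ℤ) < W - w i <;> simp [copySubst, anchor, hx, hk]
    · have hs : (∑ k : Fin (2 * W), if (k : ℤ) < W - w i then (0 : ℤ) else 1) =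
          ∑ k : Fin (2 * W), (1 - if (k : ℤ) < W - w i then (1 : ℤ) else 0) :=
        Finset.sum_congr rfl fun k _ => by split_ifs <;> rfl
      rw [Finset.sum_sub_distrib, hc] at hs
      simp only [Finset.sum_const, Finset.card_univ, Fintype.card_fin, nsmul_eq_mul] at hs
      push_cast at hs
      have hgoal : (∑ k : Fin (2 * W), if (k : ℤ) < W - w i then (0 : ℤ) else 1) =
          W - w i + 2 * (w i * 1) := by linarith
      rw [if_pos rfl, ← hgoal]
      refine Finset.sum_congr rfl fun k _ => ?_
      by_cases hk : (k : ℤ) < W - w i <;> simp [copySubst, anchor, hx, hk]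
  · simpa [copySubst, anchor] using card_fin_lt M u h0 hM

theorem abs_sum_le_mul {n W : ℕ} (w : Fin n → ℤ) (hw : ∀ i, |w i| ≤ (W : ℤ)) :
    |∑ i, w i| ≤ n * W := by
  refine (Finset.abs_sum_le_sum_abs _ _).trans ((Finset.sum_le_sum fun i _ => hw i).trans ?_)
  simp

theorem hammingDist_anchor_offset {n W M : ℕ} (L : (Fin n → ℤ) × ℤ) (d : ℤ)
    (hw : ∀ i, |L.1 i| ≤ (W : ℤ)) (hc : |L.2| ≤ (W : ℤ)) (hd0 : 0 ≤ d) (hd1 : d ≤ 1)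
    (hM : M = 2 * (n + 2) * W + 1) (x : Fin n → Bool) :
    (hammingDist (fun i => Sum.elim x id (copySubst n W M i)) (anchor W M L.1 (offset W L d)) : ℤ) =
      2 * evalZ L x + d + (2 * n + 2) * W := by
  have hs := abs_le.mp (abs_sum_le_mul L.1 hw)
  have hc := abs_le.mp hc
  rw [hammingDist_anchor L.1 _ hw (by unfold offset; linarith)
    (by unfold offset; subst hM; push_cast; linarith)]
  simp only [offset, evalZ, Finset.sum_add_distrib, Finset.sum_sub_distrib, Finset.sum_const,
    Finset.card_univ, Fintype.card_fin, nsmul_eq_mul, ← Finset.mul_sum]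
  ring

/-- an mpPTF representation with `m` terms and maximum weight `W ≥ 1`
yields, after a substitution of variables (each output coordinate is an input
variable or a constant) into dimension `nt ≤ 16(n+1)W`, a Hamming nearest neighbor
representation with at most `m` Boolean anchors. -/
theorem statement_3 {n : ℕ} (hn : 1 ≤ n) (f : (Fin n → Bool) → Bool) (m W : ℕ) (hW : 1 ≤ W)
    (a b : ℕ) (L : Fin (a + 1) → (Fin n → ℤ) × ℤ) (R : Fin (b + 1) → (Fin n → ℤ) × ℤ)
    (hm : (a + 1) + (b + 1) = m)
    (hLw : ∀ i j, |(L i).1 j| ≤ (W : ℤ)) (hLc : ∀ i, |(L i).2| ≤ (W : ℤ))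
    (hRw : ∀ i j, |(R i).1 j| ≤ (W : ℤ)) (hRc : ∀ i, |(R i).2| ≤ (W : ℤ))
    (hrep : ∀ x : Fin n → Bool,
      (f x = true ↔
        Finset.univ.inf' Finset.univ_nonempty (fun i => evalZ (L i) x) ≤
          Finset.univ.inf' Finset.univ_nonempty (fun j => evalZ (R j) x))) :
    ∃ (nt : ℕ) (σ : Fin nt → (Fin n ⊕ Bool)) (P N : Finset (Fin nt → Bool)),
      nt ≤ 16 * (n + 1) * W ∧
      P.Nonempty ∧ N.Nonempty ∧ Disjoint P N ∧ P.card + N.card ≤ m ∧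
      ∀ x : Fin n → Bool,
        (f x = true →
          ∃ p ∈ P, ∀ q ∈ N,
            hammingDist (fun i => Sum.elim x id (σ i)) p <
              hammingDist (fun i => Sum.elim x id (σ i)) q) ∧
        (f x = false →
          ∃ q ∈ N, ∀ p ∈ P,
            hammingDist (fun i => Sum.elim x id (σ i)) q <
              hammingDist (fun i => Sum.elim x id (σ i)) p) := by
  obtain ⟨M, hM⟩ : ∃ M : ℕ, M = 2 * (n + 2) * W + 1 := ⟨_, rfl⟩
  let e := (Fintype.equivFin ((Fin n × Fin (2 * W)) ⊕ Fin M)).symm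
  let p : Fin (a + 1) → _ → Bool := fun i => anchor W M (L i).1 (offset W (L i) 0) ∘ e
  let q : Fin (b + 1) → _ → Bool := fun j => anchor W M (R j).1 (offset W (R j) 1) ∘ e
  have hp (i) (x : Fin n → Bool) :
      (hammingDist (fun k => Sum.elim x id ((copySubst n W M ∘ e) k)) (p i) : ℤ) =
        2 * evalZ (L i) x + (2 * n + 2) * W := by
    have h := hammingDist_anchor_offset (L i) 0 (hLw i) (hLc i) le_rfl zero_le_one hM x
    rw [← hammingDist_comp_equiv e, add_zero] at h
    exact h
  have hq (j) (x : Fin n → Bool) :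
      (hammingDist (fun k => Sum.elim x id ((copySubst n W M ∘ e) k)) (q j) : ℤ) =
        2 * evalZ (R j) x + 1 + (2 * n + 2) * W := by
    have h := hammingDist_anchor_offset (R j) 1 (hRw j) (hRc j) zero_le_one le_rfl hM x
    rw [← hammingDist_comp_equiv e] at h
    exact h
  refine ⟨_, copySubst n W M ∘ e, Finset.univ.image p, Finset.univ.image q, ?_, by simp, by simp,
    ?_, ?_, fun x => ⟨fun hf => ?_, fun hf => ?_⟩⟩
  · simp only [Fintype.card_sum, Fintype.card_prod, Fintype.card_fin, hM]
    nlinarith [Nat.mul_le_mul hn hW]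
  · simp only [Finset.disjoint_left, Finset.mem_image, Finset.mem_univ, true_and]
    rintro _ ⟨i, rfl⟩ ⟨j, hij⟩
    have h1 := hp i (fun _ => false)
    have h2 := hq j (fun _ => false)
    rw [hij] at h2
    omega
  · rw [← hm]
    refine Nat.add_le_add (Finset.card_image_le.trans ?_) (Finset.card_image_le.trans ?_) <;> simp
  · obtain ⟨i, -, hi⟩ := Finset.exists_mem_eq_inf' Finset.univ_nonempty (fun i => evalZ (L i) x)
    have hle := (hrep x).mp hf
    rw [hi, Finset.le_inf'_iff] at hle
    refine ⟨p i, Finset.mem_image_of_mem _ (Finset.mem_univ _), ?_⟩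
    simp only [Finset.mem_image, Finset.mem_univ, true_and]
    rintro _ ⟨j, rfl⟩
    have := hle j (Finset.mem_univ _)
    zify
    rw [hp, hq]
    linarith
  · obtain ⟨j, -, hj⟩ := Finset.exists_mem_eq_inf' Finset.univ_nonempty (fun j => evalZ (R j) x)
    have hlt := mt (hrep x).mpr (by simp [hf])
    rw [not_le, hj, Finset.lt_inf'_iff] at hlt
    refine ⟨q j, Finset.mem_image_of_mem _ (Finset.mem_univ _), ?_⟩
    simp only [Finset.mem_image, Finset.mem_univ, true_and]
    rintro _ ⟨i, rfl⟩
    have := hlt i (Finset.mem_univ _)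
    zify
    rw [hp, hq]
    linarith
end

section
/- Let n ≥ 1 and define f : {0,1}^n × {0,1}^n → {0,1} by f(x, y) = 1 if and only if there exists an index i with x_i = y_i = 1 and the largest such index is odd (this is the function OMB ∘ AND₂). For 1 ≤ k ≤ n let L_k(x, y) = (k+1)·(1 − x_k − y_k). Then for all x, y ∈ {0,1}^n: f(x, y) = 1 if and only if min{ L_k(x, y) : 1 ≤ k ≤ n, k odd } ≤ min( {−1} ∪ { L_k(x, y) : 1 ≤ k ≤ n, k even } ). -/
/-- Embed a Boolean value into `ℤ`. -/
def bz (b : Bool) : ℤ := if b then 1 else 0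

/-- The form `(k+1)(1 - a - b)`, with `k` replaced by `m + 1`, is `-(m+2)` when `a = b = 1`. -/
lemma form_eq_of_both {a b : Bool} (m : ℕ) (h : a = true ∧ b = true) :
    ((m : ℤ) + 2) * (1 - bz a - bz b) = -((m : ℤ) + 2) := by
  simp [h.1, h.2, bz]

lemma form_nonneg_of_not_both {a b : Bool} (m : ℕ) (h : ¬ (a = true ∧ b = true)) :
    0 ≤ ((m : ℤ) + 2) * (1 - bz a - bz b) := by
  cases a <;> cases b <;> simp [bz] at h ⊢
  omega

/-- the function `OMB ∘ AND₂` (there is an index `i` with `x_i = y_i = 1`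
and the largest such index is odd, indices being 1-based) equals the min-plus
comparison of the forms `L_k(x,y) = (k+1)(1 - x_k - y_k)` for odd `k` against
`{-1}` together with the forms for even `k`. -/
theorem statement_4 {n : ℕ} (hn : 1 ≤ n) (x y : Fin n → Bool) :
    ((∃ i : Fin n, (x i = true ∧ y i = true) ∧ Odd (i.val + 1) ∧
        ∀ j : Fin n, (x j = true ∧ y j = true) → j ≤ i)
      ↔
      (Finset.univ.filter (fun k : Fin n => Odd (k.val + 1))).inf
          (fun k => ((((k.val : ℤ) + 2) * (1 - bz (x k) - bz (y k)) : ℤ) : WithTop ℤ)) ≤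
        min (-1 : WithTop ℤ)
          ((Finset.univ.filter (fun k : Fin n => Even (k.val + 1))).inf
            (fun k => ((((k.val : ℤ) + 2) * (1 - bz (x k) - bz (y k)) : ℤ) : WithTop ℤ)))) := by
  have coe_neg_one : (-1 : WithTop ℤ) = ((-1 : ℤ) : WithTop ℤ) := rfl
  rw [coe_neg_one, le_min_iff, Finset.le_inf_iff]
  constructor
  · rintro ⟨i, hi, hodd, hmax⟩
    have hle := Finset.inf_le
      (s := Finset.univ.filter (fun k : Fin n => Odd (k.val + 1))) (f := fun k : Fin n =>
      ((((k.val : ℤ) + 2) * (1 - bz (x k) - bz (y k)) : ℤ) : WithTop ℤ))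
      (Finset.mem_filter.2 ⟨Finset.mem_univ i, hodd⟩)
    refine ⟨hle.trans ?_, fun k _ => hle.trans ?_⟩ <;>
      simp only [WithTop.coe_le_coe, form_eq_of_both i.val hi]
    · omega
    · by_cases hk : x k = true ∧ y k = true
      · have hki : k.val ≤ i.val := hmax k hk
        rw [form_eq_of_both k.val hk]
        omega
      · have := form_nonneg_of_not_both k.val hk
        omega
  · rintro ⟨hneg, heven⟩
    have hne : (Finset.univ.filter (fun k : Fin n => Odd (k.val + 1))).Nonempty :=
      ⟨⟨0, hn⟩, by simp⟩
    obtain ⟨i, hi, hinf⟩ := Finset.exists_mem_eq_inf _ hne (fun k : Fin n =>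
      ((((k.val : ℤ) + 2) * (1 - bz (x k) - bz (y k)) : ℤ) : WithTop ℤ))
    rw [hinf, WithTop.coe_le_coe] at hneg
    have hboth : x i = true ∧ y i = true := by
      by_contra h
      have := form_nonneg_of_not_both i.val h
      omega
    refine ⟨i, hboth, (Finset.mem_filter.1 hi).2, fun j hj => ?_⟩
    have hij : ((((i.val : ℤ) + 2) * (1 - bz (x i) - bz (y i)) : ℤ) : WithTop ℤ) ≤
        ((((j.val : ℤ) + 2) * (1 - bz (x j) - bz (y j)) : ℤ) : WithTop ℤ) := by
      refine hinf.symm.le.trans ?_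
      rcases Nat.even_or_odd (j.val + 1) with h | h
      · exact heven j (Finset.mem_filter.2 ⟨Finset.mem_univ j, h⟩)
      · exact Finset.inf_le (f := fun k : Fin n =>
          ((((k.val : ℤ) + 2) * (1 - bz (x k) - bz (y k)) : ℤ) : WithTop ℤ))
          (Finset.mem_filter.2 ⟨Finset.mem_univ j, h⟩)
    rw [WithTop.coe_le_coe, form_eq_of_both i.val hboth, form_eq_of_both j.val hj] at hij
    rw [Fin.le_def]
    omega
end

section
/- There is an absolute constant c (c = 20 suffices) such that every Boolean function f : {0,1}^n → {0,1} with a min-plus polynomial threshold function (mpPTF) representation with m terms and maximum weight W ≥ 1 is computed by a linear decision list of length at most c·m²·(n+1)·W and maximum weight at most c·m·(n+1)·W. -/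
/-- An affine form with coefficients bounded by `W` is bounded by `(n + 1) * W` on the cube. -/
theorem abs_evalZ_le {n : ℕ} {W : ℤ} (F : (Fin n → ℤ) × ℤ) (hw : ∀ j, |F.1 j| ≤ W)
    (hc : |F.2| ≤ W) (x : Fin n → Bool) : |evalZ F x| ≤ (n + 1) * W := by
  have hsum : |∑ i, F.1 i * (if x i then 1 else 0)| ≤ n * W := by
    refine (Finset.abs_sum_le_sum_abs _ _).trans ?_
    have h := Finset.sum_le_card_nsmul Finset.univ
      (fun i => |F.1 i * (if x i then 1 else 0)|) W (fun i _ => by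
        have := hw i
        have := abs_nonneg (F.1 i)
        by_cases hx : x i = true <;> simp [hx] <;> lia)
    simpa using h
  unfold evalZ
  refine (abs_add_le _ _).trans ?_
  linarith

/-- The threshold test with weights `-F.1` and threshold `F.2 - v` decides `F ≤ v`. -/
theorem threshold_neg_iff {n : ℕ} (F : (Fin n → ℤ) × ℤ) (v : ℤ) (x : Fin n → Bool) :
    F.2 - v ≤ ∑ j, -F.1 j * bz (x j) ↔ evalZ F x ≤ v := by
  simp only [evalZ, bz, neg_mul, Finset.sum_neg_distrib]
  constructor <;> intro h <;> linarith

/-- with `c = 20`, every Boolean function with an mpPTF representation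
with `m` terms and maximum weight `W ≥ 1` is computed by a linear decision list of
length at most `c·m²·(n+1)·W` and maximum weight at most `c·m·(n+1)·W`. -/
theorem statement_5 {n : ℕ} (f : (Fin n → Bool) → Bool) (m W : ℕ) (hW : 1 ≤ W)
    (a b : ℕ) (L : Fin (a + 1) → (Fin n → ℤ) × ℤ) (R : Fin (b + 1) → (Fin n → ℤ) × ℤ)
    (hm : (a + 1) + (b + 1) = m)
    (hLw : ∀ i j, |(L i).1 j| ≤ (W : ℤ)) (hLc : ∀ i, |(L i).2| ≤ (W : ℤ))
    (hRw : ∀ i j, |(R i).1 j| ≤ (W : ℤ)) (hRc : ∀ i, |(R i).2| ≤ (W : ℤ))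
    (hrep : ∀ x : Fin n → Bool,
      (f x = true ↔
        Finset.univ.inf' Finset.univ_nonempty (fun i => evalZ (L i) x) ≤
          Finset.univ.inf' Finset.univ_nonempty (fun j => evalZ (R j) x))) :
    ∃ (s : ℕ) (w : Fin s → Fin n → ℤ) (θ : Fin s → ℤ) (c : Fin s → Bool),
      s ≤ 20 * m ^ 2 * (n + 1) * W ∧
      (∀ i j, |w i j| ≤ (20 * m * (n + 1) * W : ℕ)) ∧
      (∀ i, |θ i| ≤ (20 * m * (n + 1) * W : ℕ)) ∧
      ∀ x : Fin n → Bool,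
        (∀ i : Fin s,
          θ i ≤ ∑ j, w i j * bz (x j) →
          (∀ i' : Fin s, i' < i → ¬ θ i' ≤ ∑ j, w i' j * bz (x j)) →
          f x = c i) ∧
        ((∀ i : Fin s, ¬ θ i ≤ ∑ j, w i j * bz (x j)) → f x = false) := by
  subst hm
  set m := (a + 1) + (b + 1) with hm
  set B : ℕ := (n + 1) * W with hB
  have hBW : W ≤ B := Nat.le_mul_of_pos_left W n.succ_pos
  set G : Fin m → (Fin n → ℤ) × ℤ := Fin.append L R with hG
  have hGw : ∀ r j, |(G r).1 j| ≤ (W : ℤ) := fun r j => by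
    induction r using Fin.addCases <;> simp [hG, hLw, hRw]
  have hGc : ∀ r, |(G r).2| ≤ (W : ℤ) := fun r => by
    induction r using Fin.addCases <;> simp [hG, hLc, hRc]
  have hGB : ∀ r x, |evalZ (G r) x| ≤ (B : ℤ) := fun r x => by
    simpa [hB] using abs_evalZ_le (G r) (hGw r) (hGc r) x
  have hmB : B ≤ m * B := Nat.le_mul_of_pos_left B (by lia)
  have hweight : 20 * m * (n + 1) * W = 20 * (m * B) := by rw [hB]; ring
  refine ⟨(2 * B + 1) * m, fun k j => -(G k.modNat).1 j,
    fun k => (G k.modNat).2 - ((k.divNat : ℕ) - (B : ℤ)),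
    fun k => decide ((k.modNat : ℕ) < a + 1), ?_, ?_, ?_, fun x => ?_⟩
  · have hlen : 20 * m ^ 2 * (n + 1) * W = 20 * m * (m * B) := by rw [hB]; ring
    rw [hlen]
    nlinarith
  · intro k j
    rw [hweight, abs_neg]
    have := hGw k.modNat j
    lia
  · intro k
    rw [hweight]
    have := hGc k.modNat
    have := k.divNat.isLt
    rw [abs_le] at *
    lia
  simp only [threshold_neg_iff]
  have hindex : ∀ (q : ℕ) (hq : q < 2 * B + 1) (r : Fin m),
      ∃ k : Fin ((2 * B + 1) * m), (k : ℕ) = r + m * q ∧ k.divNat = ⟨q, hq⟩ ∧ k.modNat = r := by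
    intro q hq r
    refine ⟨finProdFinEquiv (⟨q, hq⟩, r), rfl, ?_⟩
    exact Prod.mk.inj (finProdFinEquiv.symm_apply_apply (⟨q, hq⟩, r))
  constructor
  · intro k hk hfirst
    have hkval : (k : ℕ) = k.modNat + m * k.divNat := (Nat.mod_add_div (k : ℕ) m).symm
    generalize hq : k.divNat = q at *
    generalize hr : k.modNat = r at *
    have hlower : ∀ r', (q : ℤ) - B ≤ evalZ (G r') x := by
      intro r'
      by_contra! hlt
      have hb := abs_le.mp (hGB r' x)
      obtain ⟨k', hk', hq', hr'⟩ := hindex (evalZ (G r') x + B).toNat (by lia) r'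
      have hqq : (evalZ (G r') x + B).toNat + 1 ≤ (q : ℕ) := by omega
      have hmul := Nat.mul_le_mul_left m hqq
      refine hfirst k' ?_ ?_
      · rw [Fin.lt_def, hkval, hk']
        have := r'.isLt
        rw [mul_add] at hmul
        lia
      · rw [hq', hr']
        simp only
        lia
    have hsame : ∀ r' < r, (q : ℤ) - B < evalZ (G r') x := by
      intro r' hlt
      obtain ⟨k', hk', hq', hr'⟩ := hindex q q.isLt r'
      have := hfirst k' (by rw [Fin.lt_def, hkval, hk']; lia)
      rw [hq', hr'] at this
      simpa using this
    induction r using Fin.addCases with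
    | left i =>
      have hlt : ((Fin.castAdd (b + 1) i : Fin m) : ℕ) < a + 1 := i.isLt
      rw [decide_eq_true hlt, hrep]
      refine (Finset.inf'_le _ (Finset.mem_univ i)).trans (Finset.le_inf' _ _ fun j _ => ?_)
      have hj := hlower (Fin.natAdd (a + 1) j)
      simp only [hG, Fin.append_left, Fin.append_right] at hk hj
      exact hk.trans hj
    | right j =>
      have hnlt : ¬ ((Fin.natAdd (a + 1) j : Fin m) : ℕ) < a + 1 := (Nat.le_add_right _ _).not_gt
      rw [decide_eq_false hnlt, ← Bool.not_eq_true, hrep, not_le]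
      refine (Finset.inf'_le _ (Finset.mem_univ j)).trans_lt
        ((Finset.lt_inf'_iff _).mpr fun i _ => ?_)
      have hi := hsame (Fin.castAdd (b + 1) i) (by
        rw [Fin.lt_def, Fin.val_castAdd, Fin.val_natAdd]; lia)
      simp only [hG, Fin.append_left, Fin.append_right] at hk hi
      exact hk.trans_lt hi
  · intro hnone
    obtain ⟨k, -, hq, hr⟩ := hindex (2 * B) (by lia) (Fin.castAdd (b + 1) 0)
    refine absurd ?_ (hnone k)
    have := abs_le.mp (hGB k.modNat x)
    rw [hq]
    push_cast
    lia
end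

section
/- Suppose f : {0,1}^n → {0,1} has a k-nearest neighbors (kNN) representation with anchor set P ∪ N of total size m, and suppose that for every x ∈ {0,1}^n the m squared distances ‖x − a‖² over anchors a ∈ P ∪ N are pairwise distinct. For each k-element subset S ⊆ P ∪ N define the affine form F_S(x) = Σ_{a ∈ S} ‖x − a‖² (an affine function of x on {0,1}^n with real coefficients). Then for every x ∈ {0,1}^n: f(x) = 1 if and only if min{ F_S(x) : |S ∩ P| ≥ |S ∩ N| } ≤ min{ F_S(x) : |S ∩ P| < |S ∩ N| }, with the convention that the minimum over an empty family is +∞. In particular, f is computed by a min-plus comparison of C(m, k) affine forms, where C(m, k) is the binomial coefficient. -/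
open scoped Classical

/-- A k-nearest neighbors (kNN) representation of a Boolean function `f`. -/
noncomputable def IsKNNRep {n : ℕ} (f : (Fin n → Bool) → Bool)
    (P N : Finset (Fin n → ℝ)) (k : ℕ) : Prop :=
  Disjoint P N ∧ 1 ≤ k ∧ k ≤ P.card + N.card ∧
    ∀ x : Fin n → Bool,
      (f x = true ↔ ∃ A ⊆ P ∪ N, A.card = k ∧ (A ∩ N).card ≤ (A ∩ P).card ∧
        ∀ a ∈ A, ∀ b ∈ (P ∪ N) \ A, sqDist (bv x) a < sqDist (bv x) b)

section NearestSubsets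

variable {α : Type*} [DecidableEq α] {U A B : Finset α} {d : α → ℝ}

/-- A subset of minimal total weight among subsets of the same size consists of the elements of
smallest weight. -/
lemma lt_of_sum_minimal (hd : ∀ a ∈ U, ∀ b ∈ U, a ≠ b → d a ≠ d b) (hA : A ⊆ U)
    (hmin : ∀ S ⊆ U, S.card = A.card → ∑ a ∈ A, d a ≤ ∑ a ∈ S, d a) :
    ∀ a ∈ A, ∀ b ∈ U \ A, d a < d b := by
  intro a ha b hb
  obtain ⟨hbU, hbA⟩ := Finset.mem_sdiff.1 hb
  have hab : a ≠ b := fun h => hbA (h ▸ ha)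
  refine lt_of_le_of_ne ?_ (hd a (hA ha) b hbU hab)
  have hb' : b ∉ A.erase a := fun h => hbA (Finset.mem_of_mem_erase h)
  have hle := hmin (insert b (A.erase a))
    (Finset.insert_subset hbU ((Finset.erase_subset _ _).trans hA))
    (by rw [Finset.card_insert_of_notMem hb', Finset.card_erase_add_one ha])
  rw [Finset.sum_insert hb', ← Finset.add_sum_erase A d ha] at hle
  linarith

/-- There is at most one subset of a given size consisting of the elements of smallest weight. -/
lemma eq_of_forall_lt_of_card_eq (hA : A ⊆ U) (hB : B ⊆ U) (hcard : A.card = B.card)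
    (hAd : ∀ a ∈ A, ∀ b ∈ U \ A, d a < d b) (hBd : ∀ a ∈ B, ∀ b ∈ U \ B, d a < d b) :
    A = B := by
  by_contra hne
  obtain ⟨a, haA, haB⟩ := Finset.not_subset.1
    fun h => hne (Finset.eq_of_subset_of_card_le h hcard.ge)
  obtain ⟨b, hbB, hbA⟩ := Finset.not_subset.1
    fun h => hne (Finset.eq_of_subset_of_card_le h hcard.le).symm
  exact lt_asymm (hAd a haA b (Finset.mem_sdiff.2 ⟨hB hbB, hbA⟩))
    (hBd b hbB a (Finset.mem_sdiff.2 ⟨hA haA, haB⟩))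

end NearestSubsets

lemma exists_sum_minimal {α : Type*} {U : Finset α} (d : α → ℝ) {k : ℕ} (hk : k ≤ U.card) :
    ∃ A ⊆ U, A.card = k ∧ ∀ S ⊆ U, S.card = k → ∑ a ∈ A, d a ≤ ∑ a ∈ S, d a := by
  obtain ⟨A, hA, hmin⟩ := Finset.exists_min_image (U.powersetCard k) (fun S => ∑ a ∈ S, d a)
    (Finset.powersetCard_nonempty.2 hk)
  obtain ⟨hAU, hAk⟩ := Finset.mem_powersetCard.1 hA
  exact ⟨A, hAU, hAk, fun S hS hSk => hmin S (Finset.mem_powersetCard.2 ⟨hS, hSk⟩)⟩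

/-- for a kNN representation with pairwise-distinct distances,
`f(x) = 1` iff the minimum of `F_S(x) = Σ_{a∈S} ‖x-a‖²` over `k`-subsets `S`
with a positive majority is at most the minimum over `k`-subsets with a negative
majority (minimum over an empty family being `+∞`, i.e. `⊤` in `WithTop ℝ`). -/
theorem statement_6 {n : ℕ} (f : (Fin n → Bool) → Bool)
    (P N : Finset (Fin n → ℝ)) (k : ℕ) (hrep : IsKNNRep f P N k)
    (hdist : ∀ x : Fin n → Bool, ∀ a ∈ P ∪ N, ∀ b ∈ P ∪ N,
      a ≠ b → sqDist (bv x) a ≠ sqDist (bv x) b)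
    (x : Fin n → Bool) :
    (f x = true ↔
      ((P ∪ N).powerset.filter
          (fun S => S.card = k ∧ (S ∩ N).card ≤ (S ∩ P).card)).inf
          (fun S => ((∑ a ∈ S, sqDist (bv x) a : ℝ) : WithTop ℝ)) ≤
        ((P ∪ N).powerset.filter
            (fun S => S.card = k ∧ (S ∩ P).card < (S ∩ N).card)).inf
          (fun S => ((∑ a ∈ S, sqDist (bv x) a : ℝ) : WithTop ℝ))) := by
  obtain ⟨hdisj, -, hk, hf⟩ := hrep
  rw [← Finset.card_union_of_disjoint hdisj] at hk
  obtain ⟨M, hMU, hMk, hmin⟩ := exists_sum_minimal (sqDist (bv x)) hk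
  rw [hf x]
  constructor
  · rintro ⟨A, hAU, hAk, hApos, hAd⟩
    obtain rfl : A = M := eq_of_forall_lt_of_card_eq hAU hMU (hAk.trans hMk.symm) hAd
      (lt_of_sum_minimal (hdist x) hMU (hMk ▸ hmin))
    refine Finset.le_inf fun S hS => ?_
    obtain ⟨hSU, hSk, -⟩ := Finset.mem_filter.1 hS
    refine (Finset.inf_le (Finset.mem_filter.2 ⟨Finset.mem_powerset.2 hAU, hAk, hApos⟩)).trans ?_
    exact WithTop.coe_le_coe.2 (hmin S (Finset.mem_powerset.1 hSU) hSk)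
  · intro hle
    by_cases hMpos : (M ∩ N).card ≤ (M ∩ P).card
    · exact ⟨M, hMU, hMk, hMpos, lt_of_sum_minimal (hdist x) hMU (hMk ▸ hmin)⟩
    · have hinf := hle.trans (Finset.inf_le
        (Finset.mem_filter.2 ⟨Finset.mem_powerset.2 hMU, hMk, not_le.1 hMpos⟩))
      obtain ⟨S, hS, hSM⟩ := (Finset.inf_le_iff (WithTop.coe_lt_top _)).1 hinf
      obtain ⟨hSU, hSk, hSpos⟩ := Finset.mem_filter.1 hS
      rw [Finset.mem_powerset] at hSU
      refine ⟨S, hSU, hSk, hSpos, lt_of_sum_minimal (hdist x) hSU fun T hTU hTk => ?_⟩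
      exact (WithTop.coe_le_coe.1 hSM).trans (hmin T hTU (hTk.trans hSk))
end

section
/- There exists a constant c > 0 such that for all positive integers n and k, every k-nearest neighbors (kNN) representation of the inner product mod 2 function IP : {0,1}^n × {0,1}^n → {0,1}, defined by IP(x, y) = Σ_{i=1}^n x_i y_i mod 2, uses at least 2^{c·n/k} anchors. -/
open scoped Classical

/-- The inner product mod 2 function on `{0,1}^n × {0,1}^n`, viewed on `{0,1}^{2n}`. -/
def IP (n : ℕ) (z : Fin (n + n) → Bool) : Bool :=
  decide ((∑ i : Fin n,
    (if z (Fin.castAdd n i) = true ∧ z (Fin.natAdd n i) = true then 1 else 0 : ℕ)) % 2 = 1)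

/-- The sign `(-1)^{⟨x, y⟩}` of the inner product mod 2. -/
noncomputable def ipSign {n : ℕ} (x y : Fin n → Bool) : ℝ :=
  ∏ i, if x i = true ∧ y i = true then -1 else 1

theorem ipSign_eq_ite_IP {n : ℕ} (x y : Fin n → Bool) :
    ipSign x y = if IP n (Fin.append x y) = true then -1 else 1 := by
  have h : ipSign x y =
      (-1) ^ (∑ i : Fin n, (if x i = true ∧ y i = true then 1 else 0 : ℕ)) := by
    rw [ipSign, ← Finset.prod_pow_eq_pow_sum]
    exact Finset.prod_congr rfl fun i _ => by split_ifs <;> simp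
  rw [h, neg_one_pow_eq_ite]
  simp only [IP, Fin.append_left, Fin.append_right, decide_eq_true_eq, Nat.even_iff]
  split_ifs <;> first | rfl | omega

theorem sum_ipSign_mul_ipSign {n : ℕ} (y z : Fin n → Bool) :
    ∑ x, ipSign x y * ipSign x z = if y = z then (2 : ℝ) ^ n else 0 := by
  have h : ∑ x, ipSign x y * ipSign x z = ∏ i, ∑ b : Bool,
      ((if b = true ∧ y i = true then -1 else 1) *
        (if b = true ∧ z i = true then -1 else 1) : ℝ) := by
    rw [Finset.prod_univ_sum, Fintype.piFinset_univ]
    exact Finset.sum_congr rfl fun x _ => by rw [ipSign, ipSign, ← Finset.prod_mul_distrib]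
  rw [h]
  split_ifs with hyz
  · subst hyz
    rw [Finset.prod_congr rfl (g := fun _ => (2 : ℝ))]
    · simp
    · intro i _
      cases y i <;> norm_num
  · obtain ⟨i, hi⟩ := Function.ne_iff.mp hyz
    refine Finset.prod_eq_zero (Finset.mem_univ i) ?_
    revert hi
    cases y i <;> cases z i <;> norm_num

/-- Lindsey's lemma for the inner product matrix. -/
theorem sq_sum_ipSign_le {n : ℕ} (X Y : Finset (Fin n → Bool)) :
    (∑ x ∈ X, ∑ y ∈ Y, ipSign x y) ^ 2 ≤ X.card * (Y.card * (2 : ℝ) ^ n) := by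
  refine sq_sum_le_card_mul_sum_sq.trans ?_
  refine mul_le_mul_of_nonneg_left ?_ (Nat.cast_nonneg _)
  calc ∑ x ∈ X, (∑ y ∈ Y, ipSign x y) ^ 2
      ≤ ∑ x, (∑ y ∈ Y, ipSign x y) ^ 2 :=
        Finset.sum_le_sum_of_subset_of_nonneg (Finset.subset_univ _) fun _ _ _ => sq_nonneg _
    _ = ∑ x, ∑ y ∈ Y, ∑ z ∈ Y, ipSign x y * ipSign x z :=
        Finset.sum_congr rfl fun x _ => by rw [sq, Finset.sum_mul_sum]
    _ = ∑ y ∈ Y, ∑ z ∈ Y, ∑ x, ipSign x y * ipSign x z := by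
        rw [Finset.sum_comm]
        exact Finset.sum_congr rfl fun y _ => Finset.sum_comm
    _ = Y.card * (2 : ℝ) ^ n := by
        simp [sum_ipSign_mul_ipSign]

/-- Monochromatic rectangles of the inner product matrix have at most `2^n` entries. -/
theorem card_mul_card_le_of_IP_const {n : ℕ} (X Y : Finset (Fin n → Bool)) (b : Bool)
    (h : ∀ x ∈ X, ∀ y ∈ Y, IP n (Fin.append x y) = b) : X.card * Y.card ≤ 2 ^ n := by
  have hs : (∑ x ∈ X, ∑ y ∈ Y, ipSign x y) ^ 2 = ((X.card : ℝ) * Y.card) ^ 2 := by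
    have : ∑ x ∈ X, ∑ y ∈ Y, ipSign x y =
        ∑ x ∈ X, ∑ y ∈ Y, (if b = true then -1 else 1 : ℝ) :=
      Finset.sum_congr rfl fun x hx => Finset.sum_congr rfl fun y hy => by
        rw [ipSign_eq_ite_IP, h x hx y hy]
    rw [this]
    cases b <;> simp
  have hle := sq_sum_ipSign_le X Y
  rw [hs] at hle
  rcases Nat.eq_zero_or_pos (X.card * Y.card) with h0 | h0
  · rw [h0]; positivity
  · have h0' : (0 : ℝ) < X.card * Y.card := by exact_mod_cast h0
    have : (X.card : ℝ) * Y.card ≤ 2 ^ n := by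
      refine le_of_mul_le_mul_left ?_ h0'
      linarith
    exact_mod_cast this

section Potential

variable {U V ι : Type*} [Fintype U] [Fintype V] [Fintype ι] [Nonempty ι]

/-- The semi-discrete transport dual of the cost `a` between `U` and the uniform measure on `ι`. -/
noncomputable def dualValue (a : U → ι → ℝ) (c : ι → ℝ) : ℝ :=
  Fintype.card ι * ∑ u, Finset.univ.inf' Finset.univ_nonempty (fun i => a u i + c i) -
    Fintype.card U * ∑ i, c i

theorem dualValue_add_const (a : U → ι → ℝ) (c : ι → ℝ) (t : ℝ) :
    dualValue a (fun i => c i + t) = dualValue a c := by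
  have h : ∀ u, Finset.univ.inf' Finset.univ_nonempty (fun i => a u i + (c i + t)) =
      Finset.univ.inf' Finset.univ_nonempty (fun i => a u i + c i) + t := by
    intro u
    refine le_antisymm ?_ ?_
    · obtain ⟨i, hi, he⟩ := Finset.exists_mem_eq_inf' Finset.univ_nonempty (fun i => a u i + c i)
      rw [he]
      exact (Finset.inf'_le _ hi).trans (by linarith)
    · refine Finset.le_inf' _ _ fun i hi => ?_
      have := Finset.inf'_le (fun i => a u i + c i) hi
      linarith
  simp only [dualValue, h, Finset.sum_add_distrib, Finset.sum_const, Finset.card_univ,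
    nsmul_eq_mul]
  ring

theorem continuous_dualValue (a : U → ι → ℝ) : Continuous (dualValue a) := by
  have h : ∀ u, Continuous fun c : ι → ℝ =>
      Finset.univ.inf' Finset.univ_nonempty (fun i => a u i + c i) := fun u =>
    Continuous.finset_inf'_apply _ fun i _ => by fun_prop
  exact ((continuous_finsetSum _ fun u _ => h u).const_mul _).sub
    ((continuous_finsetSum _ fun i _ => continuous_apply i).const_mul _)

theorem exists_forall_dualValue_le (a : U → ι → ℝ) :
    ∃ c, ∀ c', dualValue a c' ≤ dualValue a c := by
  obtain ⟨K, hK⟩ : ∃ K, ∀ p : U × ι, |a p.1 p.2| ≤ K :=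
    (Set.finite_range fun p : U × ι => |a p.1 p.2|).bddAbove.imp fun K hK p => hK ⟨p, rfl⟩
  set M : ℝ := (Fintype.card ι : ℝ) with hM
  have hMpos : 0 < M := by
    rw [hM]
    exact_mod_cast Fintype.card_pos
  set L : ℝ := max 0 (2 * M * K) with hL
  have hcomp : IsCompact (Set.Icc (0 : ι → ℝ) (fun _ => L)) := isCompact_Icc
  have h0mem : (0 : ι → ℝ) ∈ Set.Icc (0 : ι → ℝ) (fun _ => L) :=
    ⟨le_rfl, fun _ => le_max_left _ _⟩
  obtain ⟨c, -, hmax⟩ :=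
    hcomp.exists_isMaxOn ⟨0, h0mem⟩ (continuous_dualValue a).continuousOn
  refine ⟨c, fun c' => ?_⟩
  obtain ⟨j, hj⟩ := Finite.exists_min c'
  rw [← dualValue_add_const a c' (-c' j)]
  set d : ι → ℝ := fun i => c' i + -c' j with hd
  have hd0 : ∀ i, 0 ≤ d i := fun i => by have := hj i; simp only [hd]; linarith
  have hdj : d j = 0 := by simp [hd]
  by_cases hbox : ∀ i, d i ≤ L
  · exact hmax (show d ∈ Set.Icc (0 : ι → ℝ) (fun _ => L) from ⟨hd0, hbox⟩)
  · push Not at hbox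
    obtain ⟨i, hi⟩ := hbox
    refine le_trans ?_ (hmax h0mem)
    have hup : ∑ u : U, Finset.univ.inf' Finset.univ_nonempty (fun i => a u i + d i) ≤
        Fintype.card U * K := by
      rw [← nsmul_eq_mul, ← Finset.card_univ]
      refine Finset.sum_le_card_nsmul _ _ _ fun u _ => ?_
      refine (Finset.inf'_le _ (Finset.mem_univ j)).trans ?_
      rw [hdj, add_zero]
      exact (le_abs_self _).trans (hK (u, j))
    have hlow : Fintype.card U * (-K) ≤
        ∑ u : U, Finset.univ.inf' Finset.univ_nonempty (fun i => a u i + (0 : ι → ℝ) i) := by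
      rw [← nsmul_eq_mul, ← Finset.card_univ]
      refine Finset.card_nsmul_le_sum _ _ _ fun u _ => ?_
      refine Finset.le_inf' _ _ fun i _ => ?_
      have := neg_le_of_abs_le (hK (u, i))
      simpa using this
    have hsum : 2 * M * K ≤ ∑ i, d i :=
      (le_max_right _ _).trans (hi.le.trans
        (Finset.single_le_sum (fun i _ => hd0 i) (Finset.mem_univ i)))
    have hU : (0 : ℝ) ≤ Fintype.card U := Nat.cast_nonneg _
    have e1 := mul_le_mul_of_nonneg_left hup hMpos.le
    have e2 := mul_le_mul_of_nonneg_left hlow hMpos.le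
    have e3 := mul_le_mul_of_nonneg_left hsum hU
    simp only [dualValue, ← hM, Pi.zero_apply, Finset.sum_const_zero, mul_zero, sub_zero] at *
    linarith

/-- After shifting the costs by suitable potentials, every option is optimal for at least the
average number of points. -/
theorem exists_potential (a : U → ι → ℝ) :
    ∃ c : ι → ℝ, ∀ i, Fintype.card U ≤
      Fintype.card ι * (Finset.univ.filter fun u => ∀ j, a u i + c i ≤ a u j + c j).card := by
  obtain ⟨c, hc⟩ := exists_forall_dualValue_le a
  refine ⟨c, fun i => ?_⟩
  set X := Finset.univ.filter fun u => ∀ j, a u i + c i ≤ a u j + c j with hX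
  set μ : U → ℝ := fun u => Finset.univ.inf' Finset.univ_nonempty (fun i => a u i + c i) with hμ
  have hμle : ∀ u j, μ u ≤ a u j + c j := fun u j => Finset.inf'_le _ (Finset.mem_univ j)
  have hsmall : ∀ᶠ ε in nhdsWithin (0 : ℝ) (Set.Ioi 0), ∀ u, u ∉ X → μ u < a u i + c i - ε := by
    refine Filter.eventually_all.mpr fun u => ?_
    by_cases hu : u ∈ X
    · exact Filter.Eventually.of_forall fun _ h => absurd hu h
    · have : ∃ j, a u j + c j < a u i + c i := by simpa [hX] using hu
      obtain ⟨j, hj⟩ := this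
      have hpos : 0 < a u i + c i - μ u := by linarith [hμle u j]
      filter_upwards [mem_nhdsWithin_of_mem_nhds (Iio_mem_nhds hpos)] with ε hε _
      have : ε < a u i + c i - μ u := hε
      linarith
  obtain ⟨ε, hε, hpos⟩ := (hsmall.and self_mem_nhdsWithin).exists
  have hpos : 0 < ε := hpos
  have hdual := hc (fun j => c j - if j = i then ε else 0)
  have hmin : ∑ u, (μ u - if u ∈ X then ε else 0) ≤
      ∑ u, Finset.univ.inf' Finset.univ_nonempty
        (fun j => a u j + (c j - if j = i then ε else 0)) := by
    refine Finset.sum_le_sum fun u _ => Finset.le_inf' _ _ fun j _ => ?_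
    have h1 := hμle u j
    by_cases hj : j = i
    · subst hj
      by_cases hu : u ∈ X
      · simp only [hu, if_true]; linarith
      · have := hε u hu
        simp only [hu, if_true, if_false]; linarith
    · simp only [hj, if_false]
      split_ifs <;> linarith
  have hX' : ∑ u, (if u ∈ X then ε else 0) = X.card * ε := by simp
  rw [Finset.sum_sub_distrib, hX'] at hmin
  have hM : (0 : ℝ) ≤ Fintype.card ι := Nat.cast_nonneg _
  have e := mul_le_mul_of_nonneg_left hmin hM
  simp only [dualValue, Finset.sum_sub_distrib, Finset.sum_ite_eq', Finset.mem_univ,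
    if_true] at hdual
  have : (Fintype.card U : ℝ) ≤ Fintype.card ι * X.card := by
    refine le_of_mul_le_mul_right ?_ hpos
    simp only [hμ] at e
    linarith
  exact_mod_cast this

/-- The minimum of `M` functions of the form `a u i + b v i` is attained at a fixed index on a
rectangle whose sides have density at least `1 / M`. -/
theorem exists_rectangle_isMin (a : U → ι → ℝ) (b : V → ι → ℝ) :
    ∃ (i : ι) (X : Finset U) (Y : Finset V),
      Fintype.card U ≤ Fintype.card ι * X.card ∧ Fintype.card V ≤ Fintype.card ι * Y.card ∧
      ∀ u ∈ X, ∀ v ∈ Y, ∀ j, a u i + b v i ≤ a u j + b v j := by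
  obtain ⟨c, hc⟩ := exists_potential a
  choose g hg using fun v : V => Finite.exists_min fun i => b v i - c i
  obtain ⟨i, -, hi⟩ := Finset.exists_le_card_fiber_of_nsmul_le_card_of_maps_to
    (s := (Finset.univ : Finset V)) (t := (Finset.univ : Finset ι)) (f := g)
    (b := (Fintype.card V : ℚ) / Fintype.card ι) (fun _ _ => Finset.mem_univ _)
    Finset.univ_nonempty (by
      rw [nsmul_eq_mul, Finset.card_univ, Finset.card_univ, mul_div_cancel₀]
      exact_mod_cast Fintype.card_ne_zero)
  refine ⟨i, _, Finset.univ.filter fun v => g v = i, hc i, ?_, ?_⟩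
  · rw [div_le_iff₀' (by exact_mod_cast Fintype.card_pos)] at hi
    exact_mod_cast hi
  · intro u hu v hv j
    have h1 := (Finset.mem_filter.mp hu).2 j
    have h2 := hg v j
    rw [(Finset.mem_filter.mp hv).2] at h2
    linarith

/-- If `f u v` says that `a u i + b v i` has a unique minimizer `i`, and that this minimizer is
good, then `f` is constant on a rectangle whose sides have density at least `1 / M ^ 2`. -/
theorem exists_rectangle_const (a : U → ι → ℝ) (b : V → ι → ℝ) (good : ι → Prop)
    (f : U → V → Bool)
    (hf : ∀ u v, f u v = true ↔ ∃ i, good i ∧ ∀ j, j ≠ i → a u i + b v i < a u j + b v j) :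
    ∃ (t : Bool) (X : Finset U) (Y : Finset V),
      Fintype.card U ≤ Fintype.card ι ^ 2 * X.card ∧
      Fintype.card V ≤ Fintype.card ι ^ 2 * Y.card ∧
      ∀ u ∈ X, ∀ v ∈ Y, f u v = t := by
  have hgap : ∀ᶠ δ in nhdsWithin (0 : ℝ) (Set.Ioi 0), ∀ u v i j,
      a u i + b v i < a u j + b v j → a u i + b v i + 2 * δ < a u j + b v j := by
    simp only [Filter.eventually_all]
    intro u v i j h
    have hpos : 0 < (a u j + b v j - (a u i + b v i)) / 2 := by linarith
    filter_upwards [mem_nhdsWithin_of_mem_nhds (Iio_mem_nhds hpos)] with δ hδ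
    have : δ < (a u j + b v j - (a u i + b v i)) / 2 := hδ
    linarith
  obtain ⟨δ, hδ, hpos⟩ := (hgap.and self_mem_nhdsWithin).exists
  have hpos : 0 < δ := hpos
  -- Pairs of distinct options get a bonus `δ`, so that ties are won by a pair.
  obtain ⟨⟨i, j⟩, X, Y, hX, hY, hmin⟩ := exists_rectangle_isMin (ι := ι × ι)
    (fun u p => (a u p.1 + a u p.2) / 2 - if p.1 = p.2 then 0 else δ)
    (fun v p => (b v p.1 + b v p.2) / 2)
  rw [Fintype.card_prod, ← sq] at hX hY
  refine ⟨decide (i = j ∧ good i), X, Y, hX, hY, fun u hu v hv => ?_⟩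
  rw [Bool.eq_iff_iff, hf, decide_eq_true_eq]
  have hm := hmin u hu v hv
  constructor
  · rintro ⟨l, hl, huniq⟩
    have hle : ∀ p, a u l + b v l ≤ a u p + b v p := fun p => by
      by_cases hp : p = l
      · rw [hp]
      · exact (huniq p hp).le
    have h := hm (l, l)
    simp only [if_true] at h
    by_cases hij : i = j
    · subst hij
      by_cases hil : i = l
      · exact ⟨rfl, hil ▸ hl⟩
      · have := huniq i hil
        simp only [if_true] at h
        linarith
    · simp only [hij, if_false] at h
      exfalso
      by_cases hil : i = l
      · have := hδ u v l j (huniq j fun hjl => hij (hil.trans hjl.symm))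
        have := hle i
        linarith
      · have := hδ u v l i (huniq i hil)
        have := hle j
        linarith
  · rintro ⟨rfl, hi⟩
    refine ⟨i, hi, fun l hl => ?_⟩
    have h := hm (i, l)
    simp only [if_true, hl.symm, if_false] at h
    linarith

end Potential

/-- `A` consists of the strictly closest elements of `T` iff it is the unique minimizer of the
total distance among the subsets of `T` of the same cardinality. -/
theorem forall_lt_iff_sum_lt {α : Type*} [DecidableEq α] (T A : Finset α) (hA : A ⊆ T)
    (d : α → ℝ) :
    (∀ a ∈ A, ∀ b ∈ T \ A, d a < d b) ↔
      ∀ B ∈ T.powersetCard A.card, B ≠ A → ∑ a ∈ A, d a < ∑ a ∈ B, d a := by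
  constructor
  · intro h B hB hne
    obtain ⟨hBT, hcard⟩ := Finset.mem_powersetCard.mp hB
    have hsd : (A \ B).card = (B \ A).card := Finset.card_sdiff_comm hcard.symm
    have hBA : (B \ A).Nonempty := by
      rw [Finset.sdiff_nonempty]
      exact fun hsub => hne (Finset.eq_of_subset_of_card_le hsub hcard.ge)
    have hAB : (A \ B).Nonempty := by
      rw [← Finset.card_pos, hsd, Finset.card_pos]
      exact hBA
    obtain ⟨m, hm, hmax⟩ := Finset.exists_max_image (A \ B) d hAB
    have h1 : ∑ a ∈ A \ B, d a ≤ (A \ B).card • d m := Finset.sum_le_card_nsmul _ _ _ hmax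
    have h2 : ∑ _a ∈ B \ A, d m < ∑ a ∈ B \ A, d a :=
      Finset.sum_lt_sum_of_nonempty hBA fun b hb =>
        h m (Finset.mem_sdiff.mp hm).1 b
          (Finset.mem_sdiff.mpr ⟨hBT (Finset.mem_sdiff.mp hb).1, (Finset.mem_sdiff.mp hb).2⟩)
    rw [Finset.sum_const, ← hsd] at h2
    rw [← Finset.sum_sdiff_lt_sum_sdiff]
    exact h1.trans_lt h2
  · intro h a ha b hb
    obtain ⟨hbT, hbA⟩ := Finset.mem_sdiff.mp hb
    have hb' : b ∉ A.erase a := fun hmem => hbA (Finset.mem_of_mem_erase hmem)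
    have hlt := h (insert b (A.erase a)) (Finset.mem_powersetCard.mpr ⟨?_, ?_⟩) ?_
    · rw [Finset.sum_insert hb', ← Finset.add_sum_erase A d ha] at hlt
      linarith
    · exact Finset.insert_subset hbT ((Finset.erase_subset _ _).trans hA)
    · rw [Finset.card_insert_of_notMem hb', Finset.card_erase_add_one ha]
    · exact fun he => hbA (he ▸ Finset.mem_insert_self _ _)

theorem sqDist_bv_append {n : ℕ} (x y : Fin n → Bool) (a : Fin (n + n) → ℝ) :
    sqDist (bv (Fin.append x y)) a =
      sqDist (bv x) (fun i => a (Fin.castAdd n i)) +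
        sqDist (bv y) (fun i => a (Fin.natAdd n i)) := by
  simp only [sqDist, bv, Fin.sum_univ_add, Fin.append_left, Fin.append_right]

theorem two_pow_le_of_isKNNRep_IP {n k : ℕ} {P N : Finset (Fin (n + n) → ℝ)}
    (h : IsKNNRep (IP n) P N k) : 2 ^ n ≤ (P.card + N.card) ^ (4 * k) := by
  obtain ⟨hdisj, -, hk, hrep⟩ := h
  rw [← Finset.card_union_of_disjoint hdisj] at hk ⊢
  set T := P ∪ N with hT
  have : Nonempty (T.powersetCard k) := (Finset.powersetCard_nonempty.mpr hk).to_subtype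
  obtain ⟨t, X, Y, hX, hY, hconst⟩ := exists_rectangle_const (ι := T.powersetCard k)
    (fun x A => ∑ a ∈ A.1, sqDist (bv x) (fun i => a (Fin.castAdd n i)))
    (fun y A => ∑ a ∈ A.1, sqDist (bv y) (fun i => a (Fin.natAdd n i)))
    (fun A => (A.1 ∩ N).card ≤ (A.1 ∩ P).card) (fun x y => IP n (Fin.append x y)) (by
      intro x y
      rw [hrep]
      simp only [← Finset.sum_add_distrib, ← sqDist_bv_append]
      constructor
      · rintro ⟨A, hA, hAk, hgood, hlt⟩
        refine ⟨⟨A, Finset.mem_powersetCard.mpr ⟨hA, hAk⟩⟩, hgood, fun B hB => ?_⟩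
        exact (forall_lt_iff_sum_lt T A hA _).mp hlt B (hAk.symm ▸ B.2)
          fun he => hB (Subtype.ext he)
      · rintro ⟨⟨A, hAmem⟩, hgood, hlt⟩
        obtain ⟨hA, hAk⟩ := Finset.mem_powersetCard.mp hAmem
        refine ⟨A, hA, hAk, hgood, (forall_lt_iff_sum_lt T A hA _).mpr fun B hB hne => ?_⟩
        exact hlt ⟨B, hAk ▸ hB⟩ fun he => hne (congrArg Subtype.val he))
  have hcard : Fintype.card (T.powersetCard k) ≤ T.card ^ k := by
    rw [Fintype.card_coe, Finset.card_powersetCard]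
    exact Nat.choose_le_pow _ _
  have hXY := card_mul_card_le_of_IP_const X Y t hconst
  have hcube : Fintype.card (Fin n → Bool) = 2 ^ n := by simp
  rw [hcube] at hX hY
  set M := Fintype.card (T.powersetCard k)
  have hle : 2 ^ n * 2 ^ n ≤ M ^ 4 * 2 ^ n :=
    calc 2 ^ n * 2 ^ n ≤ (M ^ 2 * X.card) * (M ^ 2 * Y.card) := Nat.mul_le_mul hX hY
      _ = M ^ 4 * (X.card * Y.card) := by ring
      _ ≤ M ^ 4 * 2 ^ n := Nat.mul_le_mul_left _ hXY
  calc 2 ^ n ≤ M ^ 4 := Nat.le_of_mul_le_mul_right hle (by positivity)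
    _ ≤ (T.card ^ k) ^ 4 := Nat.pow_le_pow_left hcard 4
    _ = T.card ^ (4 * k) := by rw [← pow_mul, mul_comm]

/-- there is a constant `c > 0` such that every kNN representation of
the inner product mod 2 function on `2n` variables uses at least `2^{c·n/k}` anchors. -/
theorem statement_7 :
    ∃ c : ℝ, 0 < c ∧
      ∀ (n k : ℕ), 1 ≤ n → 1 ≤ k →
        ∀ P N : Finset (Fin (n + n) → ℝ),
          IsKNNRep (IP n) P N k →
          (2 : ℝ) ^ (c * n / k) ≤ (P.card + N.card : ℝ) := by
  refine ⟨1 / 4, by norm_num, fun n k _ hk P N h => ?_⟩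
  have hpow : (2 : ℝ) ^ n ≤ (P.card + N.card : ℝ) ^ (4 * k) := by
    exact_mod_cast two_pow_le_of_isKNNRep_IP h
  have hk' : (k : ℝ) ≠ 0 := by positivity
  refine le_of_pow_le_pow_left₀ (n := 4 * k) (by omega) (by positivity) ?_
  rw [← Real.rpow_mul_natCast (by norm_num)]
  have he : 1 / 4 * (n : ℝ) / k * ((4 * k : ℕ) : ℝ) = n := by
    push_cast
    field_simp
  rwa [he, Real.rpow_natCast]
end

section
/- Let n, s ≥ 1, let g : {0,1}^s → {0,1} be a symmetric function (g(y) depends only on y_1 + … + y_s), and for 1 ≤ i ≤ s let f_i : {0,1}^n → {0,1} be a nonempty conjunction of literals: f_i(x) = 1 iff x_j = 1 for all j ∈ S_i and x_j = 0 for all j ∈ T_i, where S_i, T_i ⊆ {1, …, n} are disjoint and S_i ∪ T_i ≠ ∅. Define f : {0,1}^n → {0,1} by f(x) = g(f_1(x), …, f_s(x)). Then f has a k-nearest neighbors (kNN) representation with at most 6s + 4 anchors in ℝ^n and k = 2s + 1. -/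
open scoped Classical

/-- The sign of the literal on coordinate `j` in the conjunction of `S` (positive) and `T`
(negative). -/
noncomputable def litSign {n : ℕ} (S T : Finset (Fin n)) (j : Fin n) : ℝ :=
  if j ∈ S then 1 else if j ∈ T then -1 else 0

/-- The point at offset `t` from the centre of the cube, in the direction of the face on which the
conjunction of `S` and `T` holds. -/
noncomputable def conjAnchor {n : ℕ} (S T : Finset (Fin n)) (t : ℝ) : Fin n → ℝ :=
  fun j => 1 / 2 + t * litSign S T j

/-- The point at offset `δ` from the centre of the cube along the coordinate `i`. -/
noncomputable def axisAnchor {n : ℕ} (i : Fin n) (δ : ℝ) : Fin n → ℝ :=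
  fun j => 1 / 2 + if j = i then δ else 0

/-- The sign `1` or `-1` of a Boolean. -/
def boolSign (b : Bool) : ℤ := if b then 1 else -1

lemma abs_litSign_of_mem {n : ℕ} {S T : Finset (Fin n)} {j : Fin n} (hj : j ∈ S ∪ T) :
    |litSign S T j| = 1 := by
  unfold litSign
  rw [Finset.mem_union] at hj
  split_ifs <;> simp_all

lemma abs_litSign_eq_zero_or_one {n : ℕ} (S T : Finset (Fin n)) (j : Fin n) :
    |litSign S T j| = 0 ∨ |litSign S T j| = 1 := by
  unfold litSign
  split_ifs <;> simp

lemma sqDist_eq_add_sum {n : ℕ} (u v : Fin n → ℝ) :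
    sqDist u v = n / 4 + ∑ j, ((u j - v j) ^ 2 - 1 / 4) := by
  simp only [sqDist, Finset.sum_sub_distrib, Finset.sum_const, Finset.card_univ, Fintype.card_fin,
    nsmul_eq_mul]
  ring

lemma sqDist_axisAnchor {n : ℕ} (x : Fin n → Bool) (i : Fin n) (δ : ℝ) :
    sqDist (bv x) (axisAnchor i δ) = n / 4 + (δ ^ 2 - (if x i then δ else -δ)) := by
  rw [sqDist_eq_add_sum, Finset.sum_eq_single i]
  · cases h : x i <;> simp [bv, axisAnchor, h] <;> ring
  · intro j _ hj
    cases h : x j <;> simp [bv, axisAnchor, h, hj] <;> norm_num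
  · simp

lemma sqDist_conjAnchor_of_true {n : ℕ} {S T : Finset (Fin n)}
    (hne : (S ∪ T).Nonempty) {x : Fin n → Bool}
    (hx : (∀ j ∈ S, x j = true) ∧ (∀ j ∈ T, x j = false)) {t : ℝ} (h0 : 0 ≤ t) (h1 : t ≤ 1) :
    sqDist (bv x) (conjAnchor S T t) ≤ n / 4 - t * (1 - t) := by
  have key : ∀ j, (bv x j - conjAnchor S T t j) ^ 2 - 1 / 4 =
      if j ∈ S ∪ T then -(t * (1 - t)) else 0 := by
    intro j
    by_cases hS : j ∈ S
    · simp [bv, conjAnchor, litSign, hS, hx.1 j hS]; ring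
    · by_cases hT : j ∈ T
      · simp [bv, conjAnchor, litSign, hS, hT, hx.2 j hT]; ring
      · cases h : x j <;> simp [bv, conjAnchor, litSign, hS, hT, h] <;> norm_num
  have hp : 0 ≤ t * (1 - t) := mul_nonneg h0 (by linarith)
  obtain ⟨j, hj⟩ := hne
  rw [sqDist_eq_add_sum, ← Finset.add_sum_erase _ _ (Finset.mem_univ j), key, if_pos hj]
  have : ∑ i ∈ Finset.univ.erase j, ((bv x i - conjAnchor S T t i) ^ 2 - 1 / 4) ≤ 0 := by
    refine Finset.sum_nonpos fun i _ => ?_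
    rw [key]
    split_ifs <;> linarith
  linarith

lemma sqDist_conjAnchor_of_false {n : ℕ} {S T : Finset (Fin n)} (hST : Disjoint S T)
    {x : Fin n → Bool}
    (hx : ¬ ((∀ j ∈ S, x j = true) ∧ (∀ j ∈ T, x j = false))) {t : ℝ} (h0 : 0 ≤ t) (h1 : t ≤ 1) :
    n / 4 + (t ^ 2 + t) - n * (t * (1 - t)) ≤ sqDist (bv x) (conjAnchor S T t) := by
  have hp : 0 ≤ t * (1 - t) := mul_nonneg h0 (by linarith)
  have key : ∀ j, -(t * (1 - t)) ≤ (bv x j - conjAnchor S T t j) ^ 2 - 1 / 4 := by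
    intro j
    unfold bv conjAnchor litSign
    split_ifs <;> nlinarith
  obtain ⟨j, hj⟩ : ∃ j, (bv x j - conjAnchor S T t j) ^ 2 - 1 / 4 = t ^ 2 + t := by
    by_contra! hcon
    refine hx ⟨fun j hj => ?_, fun j hj => ?_⟩
    · by_contra h
      refine hcon j ?_
      simp [bv, conjAnchor, litSign, hj, h]; ring
    · by_contra h
      refine hcon j ?_
      have hS : j ∉ S := fun hS => Finset.disjoint_left.mp hST hS hj
      simp [bv, conjAnchor, litSign, hj, hS, Bool.eq_true_of_not_eq_false h]; ring
  rw [sqDist_eq_add_sum, ← Finset.add_sum_erase _ _ (Finset.mem_univ j), hj]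
  have h2 : ∑ _i ∈ Finset.univ.erase j, (-(t * (1 - t))) ≤
      ∑ i ∈ Finset.univ.erase j, ((bv x i - conjAnchor S T t i) ^ 2 - 1 / 4) :=
    Finset.sum_le_sum fun i _ => key i
  have h3 : ∑ _i : Fin n, (-(t * (1 - t))) ≤ ∑ _i ∈ Finset.univ.erase j, (-(t * (1 - t))) := by
    rw [← Finset.add_sum_erase _ _ (Finset.mem_univ j)]
    linarith
  rw [Finset.sum_const, Finset.card_univ, Fintype.card_fin, nsmul_eq_mul] at h3
  linarith

lemma sum_boolSign {ι : Type*} (B : Finset ι) (lab : ι → Bool) :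
    ∑ i ∈ B, boolSign (lab i) =
      ((B.filter fun i => lab i = true).card : ℤ) - (B.filter fun i => lab i = false).card := by
  rw [Finset.card_filter, Finset.card_filter]
  push_cast
  rw [← Finset.sum_sub_distrib]
  refine Finset.sum_congr rfl fun i _ => ?_
  cases lab i <;> simp [boolSign]

/-- A labelled injective family of anchors, with an explicit set of `k` nearest ones for each
input, yields a kNN representation. -/
lemma isKNNRep_of_family {n k : ℕ} {ι : Type*} [Fintype ι] (f : (Fin n → Bool) → Bool)
    (φ : ι → Fin n → ℝ) (hφ : Function.Injective φ) (lab : ι → Bool) (hk : 1 ≤ k)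
    (B : (Fin n → Bool) → Finset ι) (hcard : ∀ x, (B x).card = k)
    (hB : ∀ x, ∀ a ∈ B x, ∀ b ∉ B x, sqDist (bv x) (φ a) < sqDist (bv x) (φ b))
    (hf : ∀ x, f x = true ↔ 0 ≤ ∑ i ∈ B x, boolSign (lab i)) :
    ∃ P N : Finset (Fin n → ℝ), IsKNNRep f P N k ∧ P.card + N.card = Fintype.card ι := by
  set P := (Finset.univ.filter fun i => lab i = true).image φ with hP
  set N := (Finset.univ.filter fun i => lab i = false).image φ with hN
  have hdisj : Disjoint P N := by
    rw [hP, hN, Finset.disjoint_image hφ]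
    exact Finset.disjoint_left.mpr fun i h h' => by simp_all
  have hU : P ∪ N = Finset.univ.image φ := by
    rw [hP, hN, ← Finset.image_union]
    congr 1
    ext i
    cases h : lab i <;> simp [h]
  have hsum : P.card + N.card = Fintype.card ι := by
    rw [← Finset.card_union_of_disjoint hdisj, hU, Finset.card_image_of_injective _ hφ,
      Finset.card_univ]
  have hBP : ∀ x, ((B x).image φ ∩ P).card = ((B x).filter fun i => lab i = true).card := by
    intro x
    rw [hP, ← Finset.image_inter _ _ hφ, Finset.card_image_of_injective _ hφ]
    congr 1
    ext i
    simp
  have hBN : ∀ x, ((B x).image φ ∩ N).card = ((B x).filter fun i => lab i = false).card := by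
    intro x
    rw [hN, ← Finset.image_inter _ _ hφ, Finset.card_image_of_injective _ hφ]
    congr 1
    ext i
    simp
  refine ⟨P, N, ⟨hdisj, hk, ?_, fun x => ?_⟩, hsum⟩
  · rw [hsum, ← hcard fun _ => false]
    exact Finset.card_le_univ _
  have hf' : f x = true ↔ ((B x).image φ ∩ N).card ≤ ((B x).image φ ∩ P).card := by
    rw [hf, sum_boolSign, hBP, hBN]
    omega
  have hcB : ((B x).image φ).card = k := by
    rw [Finset.card_image_of_injective _ hφ, hcard]
  have hsub : (B x).image φ ⊆ P ∪ N := hU ▸ Finset.image_subset_image (Finset.subset_univ _)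
  have hnear : ∀ a ∈ (B x).image φ, ∀ b ∈ (P ∪ N) \ (B x).image φ,
      sqDist (bv x) a < sqDist (bv x) b := by
    intro a ha b hb
    rw [hU, Finset.mem_sdiff] at hb
    obtain ⟨i, hi, rfl⟩ := Finset.mem_image.mp ha
    obtain ⟨j, _, rfl⟩ := Finset.mem_image.mp hb.1
    exact hB x i hi j fun hj => hb.2 (Finset.mem_image_of_mem φ hj)
  rw [hf']
  refine ⟨fun h => ⟨_, hsub, hcB, h, hnear⟩, ?_⟩
  rintro ⟨A, hA, hAk, hle, hAnear⟩
  suffices A = (B x).image φ by rwa [this] at hle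
  by_contra hne
  have hAB : ¬ A ⊆ (B x).image φ := fun h =>
    hne (Finset.eq_of_subset_of_card_le h (by rw [hcB, hAk]))
  have hBA : ¬ (B x).image φ ⊆ A := fun h =>
    hne (Finset.eq_of_subset_of_card_le h (by rw [hcB, hAk])).symm
  obtain ⟨a, ha, ha'⟩ := Finset.not_subset.mp hAB
  obtain ⟨b, hb, hb'⟩ := Finset.not_subset.mp hBA
  exact lt_asymm (hAnear a ha b (Finset.mem_sdiff.mpr ⟨hsub hb, hb'⟩))
    (hnear b hb a (Finset.mem_sdiff.mpr ⟨hA ha, ha'⟩))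

lemma conjAnchor_injective_param {n : ℕ} {S T S' T' : Finset (Fin n)} (hne : (S ∪ T).Nonempty)
    {t t' : ℝ} (ht : 0 < t) (ht' : 0 < t') (h : conjAnchor S T t = conjAnchor S' T' t') :
    t = t' := by
  obtain ⟨j, hj⟩ := hne
  have h1 : t * litSign S T j = t' * litSign S' T' j := by
    simpa [conjAnchor] using congrFun h j
  have h2 := congrArg abs h1
  rw [abs_mul, abs_mul, abs_litSign_of_mem hj, abs_of_pos ht, abs_of_pos ht'] at h2
  rcases abs_litSign_eq_zero_or_one S' T' j with h3 | h3 <;> rw [h3] at h2 <;> linarith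

lemma conjAnchor_ne_axisAnchor {n : ℕ} {S T : Finset (Fin n)} (hne : (S ∪ T).Nonempty)
    {t δ : ℝ} (ht : |δ| < t) (i : Fin n) : conjAnchor S T t ≠ axisAnchor i δ := by
  intro h
  obtain ⟨j, hj⟩ := hne
  have h1 : t * litSign S T j = if j = i then δ else 0 := by
    simpa [conjAnchor, axisAnchor] using congrFun h j
  have h2 := congrArg abs h1
  have h0 := abs_nonneg δ
  rw [abs_mul, abs_litSign_of_mem hj, abs_of_pos (by linarith)] at h2
  split_ifs at h2
  · linarith
  · simp at h2
    linarith

/-- Sums over `Fin (s + 1)` of a function that vanishes beyond `d` and is constant below `d`. -/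
lemma sum_fin_step {s d : ℕ} (hd : d ≤ s) (p : ℤ) (q : Fin (s + 1) → ℤ) :
    ∑ r : Fin (s + 1), ((if (r : ℕ) < d then p else 0) + if (r : ℕ) = d then q r else 0) =
      d * p + q ⟨d, Nat.lt_succ_of_le hd⟩ := by
  rw [Finset.sum_add_distrib]
  congr 1
  · rw [Fin.sum_univ_eq_sum_range (fun r => if r < d then p else 0), ← Finset.sum_filter,
      Finset.sum_const, nsmul_eq_mul]
    have : (Finset.range (s + 1)).filter (· < d) = Finset.range d := by
      ext r; simp; omega
    rw [this, Finset.card_range]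
  · rw [Finset.sum_eq_single ⟨d, Nat.lt_succ_of_le hd⟩]
    · simp
    · intro r _ hr
      rw [if_neg fun h => hr (Fin.ext h)]
    · simp

/-- Indices of anchors: a pair for each conjunction, and two mirrored sequences of `s + 1` pairs
along one axis. -/
abbrev AnchorIndex (s : ℕ) := (Fin s × Bool) ⊕ (Fin (s + 1) × Bool × Bool)

/-- The anchors nearest to an input: both anchors of each satisfied conjunction, and the first
`2 * d + 1` anchors of the sequence on the given side. -/
noncomputable def nearestIndices {s : ℕ} (y : Fin s → Prop) (d : ℕ) (side : Bool) :
    Finset (AnchorIndex s) :=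
  Finset.univ.filter <| Sum.elim (fun a => y a.1)
    fun b => b.2.2 = side ∧ 2 * (b.1 : ℕ) + b.2.1.toNat ≤ 2 * d

lemma sum_nearestIndices {s d : ℕ} (hd : d ≤ s) (y : Fin s → Prop) (side : Bool)
    (h : AnchorIndex s → ℤ) (p₁ p₂ : ℤ)
    (h₁ : ∀ i, h (.inl (i, true)) + h (.inl (i, false)) = p₁)
    (h₂ : ∀ r, h (.inr (r, true, side)) + h (.inr (r, false, side)) = p₂) :
    ∑ i ∈ nearestIndices y d side, h i =
      (∑ i, if y i then p₁ else 0) +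
        (d * p₂ + h (.inr (⟨d, Nat.lt_succ_of_le hd⟩, false, side))) := by
  rw [nearestIndices, Finset.sum_filter, Fintype.sum_sum_type]
  congr 1
  · rw [Fintype.sum_prod_type]
    refine Finset.sum_congr rfl fun i _ => ?_
    rw [Fintype.sum_bool, ← h₁ i]
    by_cases hi : y i <;> simp [hi]
  · rw [← sum_fin_step hd p₂ fun r => h (.inr (r, false, side)), Fintype.sum_prod_type]
    refine Finset.sum_congr rfl fun r _ => ?_
    rw [Fintype.sum_prod_type, Fintype.sum_bool, Fintype.sum_bool, Fintype.sum_bool, ← h₂ r]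
    rcases lt_trichotomy (r : ℕ) d with hr | hr | hr
    · have e1 : 2 * (r : ℕ) + 1 ≤ 2 * d := by omega
      cases side <;> simp [hr, hr.le, hr.ne, e1]
    · cases side <;> simp [hr]
    · have e1 : ¬ 2 * (r : ℕ) + 1 ≤ 2 * d := by omega
      cases side <;> simp [hr.ne', e1, not_le.mpr hr, not_lt.mpr hr.le]

lemma card_nearestIndices {s d : ℕ} (hd : d ≤ s) (y : Fin s → Prop) (side : Bool)
    (hy : (∑ i, if y i then 1 else 0 : ℕ) + d = s) :
    (nearestIndices y d side).card = 2 * s + 1 := by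
  have h := sum_nearestIndices hd y side (fun _ => 1) 2 2 (by simp) (by simp)
  have e : (∑ i, if y i then (2 : ℤ) else 0) = 2 * ((∑ i, if y i then 1 else 0 : ℕ) : ℤ) := by
    push_cast
    rw [Finset.mul_sum]
    exact Finset.sum_congr rfl fun i _ => by split_ifs <;> simp
  rw [e, Finset.sum_const, nsmul_eq_mul, mul_one] at h
  omega

/-- The offset from `1` of the two anchors of each conjunction. -/
noncomputable def conjOffset {s : ℕ} (η : ℝ) (a : Fin s × Bool) : ℝ :=
  η * (1 + (2 * (a.1 : ℕ) + a.2.toNat : ℕ))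

/-- The axis offset of an anchor in the mirrored sequences; the nearest one has the largest
absolute offset. -/
noncomputable def axisOffset {s : ℕ} (ε : ℝ) (b : Fin (s + 1) × Bool × Bool) : ℝ :=
  (if b.2.2 then 1 else -1) * (ε * (2 * s + 2 - (2 * (b.1 : ℕ) + b.2.1.toNat : ℕ)))

/-- The family of anchors. -/
noncomputable def anchorFamily {n s : ℕ} (S T : Fin s → Finset (Fin n)) (i₀ : Fin n) (η ε : ℝ) :
    AnchorIndex s → Fin n → ℝ :=
  Sum.elim (fun a => conjAnchor (S a.1) (T a.1) (1 - conjOffset η a))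
    fun b => axisAnchor i₀ (axisOffset ε b)

lemma toNat_le_one (b : Bool) : b.toNat ≤ 1 := by cases b <;> simp

lemma conjOffset_bounds {s : ℕ} {η : ℝ} (hη : 0 < η) (a : Fin s × Bool) :
    η ≤ conjOffset η a ∧ conjOffset η a ≤ η * (2 * s) := by
  have h1 := a.1.2
  have h2 := toNat_le_one a.2
  have h3 : 1 + (2 * (a.1 : ℕ) + a.2.toNat) ≤ 2 * s := by omega
  have h4 : (1 : ℝ) + (2 * (a.1 : ℕ) + a.2.toNat : ℕ) ≤ 2 * s := by exact_mod_cast h3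
  have h5 : (0 : ℝ) ≤ (2 * (a.1 : ℕ) + a.2.toNat : ℕ) := Nat.cast_nonneg _
  unfold conjOffset
  constructor <;> nlinarith

lemma conjOffset_injective {s : ℕ} {η : ℝ} (hη : 0 < η) :
    Function.Injective (conjOffset η : Fin s × Bool → ℝ) := by
  rintro ⟨i, b⟩ ⟨i', b'⟩ h
  have h1 : 2 * (i : ℕ) + b.toNat = 2 * (i' : ℕ) + b'.toNat := by
    simpa only [conjOffset, mul_right_inj' hη.ne', add_right_inj, Nat.cast_inj] using h
  have h2 : i = i' := by
    have := toNat_le_one b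
    have := toNat_le_one b'
    exact Fin.ext (by omega)
  subst h2
  cases b <;> cases b' <;> simp_all

lemma axisOffset_factor_bounds {s : ℕ} (b : Fin (s + 1) × Bool × Bool) :
    (1 : ℝ) ≤ 2 * s + 2 - (2 * (b.1 : ℕ) + b.2.1.toNat : ℕ) ∧
      (2 * s + 2 - (2 * (b.1 : ℕ) + b.2.1.toNat : ℕ) : ℝ) ≤ 2 * s + 2 := by
  have h1 := b.1.2
  have h2 := toNat_le_one b.2.1
  have h3 : 1 + (2 * (b.1 : ℕ) + b.2.1.toNat) ≤ 2 * s + 2 := by omega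
  have h4 : (1 : ℝ) + (2 * (b.1 : ℕ) + b.2.1.toNat : ℕ) ≤ 2 * s + 2 := by exact_mod_cast h3
  have h5 : (0 : ℝ) ≤ (2 * (b.1 : ℕ) + b.2.1.toNat : ℕ) := Nat.cast_nonneg _
  constructor <;> linarith

lemma abs_axisOffset_le {s : ℕ} {ε : ℝ} (hε : 0 < ε) (b : Fin (s + 1) × Bool × Bool) :
    |axisOffset ε b| ≤ ε * (2 * s + 2) := by
  obtain ⟨h1, h2⟩ := axisOffset_factor_bounds b
  unfold axisOffset
  rw [abs_le]
  split_ifs <;> constructor <;> nlinarith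

lemma axisOffset_injective {s : ℕ} {ε : ℝ} (hε : 0 < ε) :
    Function.Injective (axisOffset ε : Fin (s + 1) × Bool × Bool → ℝ) := by
  rintro ⟨r, b, c⟩ ⟨r', b', c'⟩ h
  have h1 := mul_pos hε (zero_lt_one.trans_le (axisOffset_factor_bounds (r, b, c)).1)
  have h1' := mul_pos hε (zero_lt_one.trans_le (axisOffset_factor_bounds (r', b', c')).1)
  have hc : c = c' ∧ ε * (2 * s + 2 - (2 * (r : ℕ) + b.toNat : ℕ)) =
      ε * (2 * s + 2 - (2 * (r' : ℕ) + b'.toNat : ℕ)) := by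
    unfold axisOffset at h
    dsimp only at h h1 h1'
    cases c <;> cases c' <;> simp only [if_true, Bool.false_eq_true, if_false] at h <;>
      first
        | exact ⟨rfl, by linarith⟩
        | linarith
  obtain ⟨rfl, h2⟩ := hc
  have h3 : 2 * (r : ℕ) + b.toNat = 2 * (r' : ℕ) + b'.toNat := by
    simpa only [mul_right_inj' hε.ne', sub_right_inj, Nat.cast_inj] using h2
  have h4 : r = r' := by
    have := toNat_le_one b
    have := toNat_le_one b'
    exact Fin.ext (by omega)
  subst h4
  cases b <;> cases b' <;> simp_all

lemma anchorFamily_injective {n s : ℕ} {S T : Fin s → Finset (Fin n)}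
    (hne : ∀ i, (S i ∪ T i).Nonempty) (i₀ : Fin n) {η ε : ℝ} (hη : 0 < η) (hε : 0 < ε)
    (hη' : η * (2 * s) ≤ 1 / 2) (hε' : ε * (2 * s + 2) < 1 / 2) :
    Function.Injective (anchorFamily S T i₀ η ε) := by
  have hpos : ∀ a : Fin s × Bool, 1 / 2 ≤ 1 - conjOffset η a := fun a => by
    linarith [(conjOffset_bounds hη a).2]
  have hax : ∀ (a : Fin s × Bool) (b : Fin (s + 1) × Bool × Bool),
      |axisOffset ε b| < 1 - conjOffset η a := fun a b => by
    linarith [hpos a, abs_axisOffset_le hε b]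
  rintro (a | b) (a' | b') h
  · have := conjAnchor_injective_param (hne a.1) (by linarith [hpos a]) (by linarith [hpos a']) h
    rw [conjOffset_injective hη (show conjOffset η a = conjOffset η a' by linarith)]
  · exact absurd h (conjAnchor_ne_axisAnchor (hne a.1) (hax a b') i₀)
  · exact absurd h.symm (conjAnchor_ne_axisAnchor (hne a'.1) (hax a' b) i₀)
  · have h1 := congrFun h i₀
    simp only [anchorFamily, Sum.elim_inr, axisAnchor, if_true, add_right_inj] at h1
    rw [axisOffset_injective hε h1]

lemma anchorFamily_separated {n s d : ℕ} {S T : Fin s → Finset (Fin n)}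
    (hST : ∀ i, Disjoint (S i) (T i)) (hne : ∀ i, (S i ∪ T i).Nonempty) (i₀ : Fin n) {η ε : ℝ}
    (hη : 0 < η) (hη1 : η ≤ 1 / 2) (hε : 0 < ε) (hη' : n * (η * (2 * s)) ≤ 1 / 2)
    (hε' : ε * (2 * s + 2) ≤ η / 8) (x : Fin n → Bool) {a b : AnchorIndex s}
    (ha : a ∈ nearestIndices
      (fun i => (∀ j ∈ S i, x j = true) ∧ (∀ j ∈ T i, x j = false)) d (x i₀))
    (hb : b ∉ nearestIndices
      (fun i => (∀ j ∈ S i, x j = true) ∧ (∀ j ∈ T i, x j = false)) d (x i₀)) :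
    sqDist (bv x) (anchorFamily S T i₀ η ε a) < sqDist (bv x) (anchorFamily S T i₀ η ε b) := by
  have hn : (1 : ℝ) ≤ n := by exact_mod_cast (Nat.zero_le _).trans_lt i₀.2
  have hle : ∀ c : Fin s × Bool, η ≤ conjOffset η c ∧ n * conjOffset η c ≤ 1 / 2 ∧
      conjOffset η c ≤ 1 / 2 := fun c => by
    obtain ⟨h1, h2⟩ := conjOffset_bounds hη c
    have h3 : n * conjOffset η c ≤ 1 / 2 :=
      (mul_le_mul_of_nonneg_left h2 (by linarith)).trans hη'
    exact ⟨h1, h3, by nlinarith⟩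
  have htrue : ∀ c : Fin s × Bool,
      ((∀ j ∈ S c.1, x j = true) ∧ (∀ j ∈ T c.1, x j = false)) →
      sqDist (bv x) (anchorFamily S T i₀ η ε (.inl c)) ≤ n / 4 - η / 2 := fun c hc => by
    obtain ⟨h1, h2, h3⟩ := hle c
    have := sqDist_conjAnchor_of_true (hne c.1) hc (t := 1 - conjOffset η c)
      (by linarith) (by linarith)
    refine this.trans ?_
    nlinarith
  have hfalse : ∀ c : Fin s × Bool,
      ¬ ((∀ j ∈ S c.1, x j = true) ∧ (∀ j ∈ T c.1, x j = false)) →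
      n / 4 + 1 / 4 ≤ sqDist (bv x) (anchorFamily S T i₀ η ε (.inl c)) := fun c hc => by
    obtain ⟨h1, h2, h3⟩ := hle c
    have := sqDist_conjAnchor_of_false (hST c.1) hc (t := 1 - conjOffset η c)
      (by linarith) (by linarith)
    refine le_trans ?_ this
    have h4 : (n : ℝ) * ((1 - conjOffset η c) * (1 - (1 - conjOffset η c))) ≤
        n * conjOffset η c := mul_le_mul_of_nonneg_left (by nlinarith) (by linarith)
    nlinarith
  have haxis : ∀ c, |axisOffset ε c| ≤ η / 8 := fun c => (abs_axisOffset_le hε c).trans hε'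
  have hmid : ∀ c, n / 4 - η / 2 < sqDist (bv x) (anchorFamily S T i₀ η ε (.inr c)) ∧
      sqDist (bv x) (anchorFamily S T i₀ η ε (.inr c)) < n / 4 + 1 / 4 := fun c => by
    obtain ⟨h1, h2⟩ := abs_le.mp (haxis c)
    simp only [anchorFamily, Sum.elim_inr, sqDist_axisAnchor]
    split_ifs <;> constructor <;> nlinarith
  simp only [nearestIndices, Finset.mem_filter, Finset.mem_univ, true_and] at ha hb
  rcases a with a | a <;> rcases b with b | b <;> simp only [Sum.elim_inl, Sum.elim_inr] at ha hb
  · linarith [htrue a ha, hfalse b hb]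
  · linarith [htrue a ha, (hmid b).1]
  · linarith [(hmid a).2, hfalse b hb]
  · obtain ⟨ha1, ha2⟩ := ha
    have hlt : (if x i₀ then axisOffset ε b else -axisOffset ε b) <
        (if x i₀ then axisOffset ε a else -axisOffset ε a) := by
      have fa := mul_pos hε (zero_lt_one.trans_le (axisOffset_factor_bounds a).1)
      have fb := mul_pos hε (zero_lt_one.trans_le (axisOffset_factor_bounds b).1)
      by_cases hb1 : b.2.2 = x i₀
      · have hq : 2 * (a.1 : ℕ) + a.2.1.toNat < 2 * (b.1 : ℕ) + b.2.1.toNat := by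
          by_contra hcon
          exact hb ⟨hb1, (not_lt.mp hcon).trans ha2⟩
        have hq' : ((2 * (a.1 : ℕ) + a.2.1.toNat : ℕ) : ℝ) < (2 * (b.1 : ℕ) + b.2.1.toNat : ℕ) :=
          Nat.cast_lt.mpr hq
        have := mul_lt_mul_of_pos_left hq' hε
        unfold axisOffset
        rw [ha1, hb1]
        split_ifs <;> linarith
      · unfold axisOffset
        cases hx : x i₀ <;> rw [hx] at ha1 hb1 <;>
          simp only [ha1, hb1, if_true, Bool.false_eq_true, if_false] <;> linarith
    obtain ⟨h1, h2⟩ := abs_le.mp (haxis a)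
    obtain ⟨h3, h4⟩ := abs_le.mp (haxis b)
    simp only [anchorFamily, Sum.elim_inr, sqDist_axisAnchor]
    split_ifs at hlt ⊢ <;> nlinarith

/-- if `g : {0,1}^s → {0,1}` is symmetric and each `f_i` is a nonempty
conjunction of literals, then `f(x) = g(f_1(x), …, f_s(x))` has a kNN representation
with at most `6s + 4` anchors in `ℝ^n` and `k = 2s + 1`. -/
theorem statement_13 {n s : ℕ} (hn : 1 ≤ n) (hs : 1 ≤ s)
    (g : (Fin s → Bool) → Bool)
    (hg : ∀ y z : Fin s → Bool,
      (∑ i, if y i then 1 else 0 : ℕ) = (∑ i, if z i then 1 else 0) → g y = g z)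
    (S T : Fin s → Finset (Fin n))
    (hST : ∀ i, Disjoint (S i) (T i))
    (hne : ∀ i, (S i ∪ T i).Nonempty)
    (f : (Fin n → Bool) → Bool)
    (hf : ∀ x, f x = g (fun i =>
      decide ((∀ j ∈ S i, x j = true) ∧ (∀ j ∈ T i, x j = false)))) :
    ∃ P N : Finset (Fin n → ℝ),
      IsKNNRep f P N (2 * s + 1) ∧ P.card + N.card ≤ 6 * s + 4 := by
  have hn' : (1 : ℝ) ≤ n := by exact_mod_cast hn
  have hs' : (1 : ℝ) ≤ s := by exact_mod_cast hs
  obtain ⟨η, hη, hη'⟩ : ∃ η : ℝ, 0 < η ∧ n * (η * (2 * s)) = 1 / 2 :=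
    ⟨1 / (4 * n * s), by positivity, by field_simp; norm_num⟩
  obtain ⟨ε, hε, hε'⟩ : ∃ ε : ℝ, 0 < ε ∧ ε * (2 * s + 2) = η / 8 :=
    ⟨η / (8 * (2 * s + 2)), by positivity, by field_simp⟩
  have hη2 : η * (2 * s) ≤ 1 / 2 := by
    have : 0 ≤ η * (2 * s) := by positivity
    nlinarith
  have hη1 : η ≤ 1 / 2 := by nlinarith
  let i₀ : Fin n := ⟨0, hn⟩
  let y (x : Fin n → Bool) (i : Fin s) : Prop :=
    (∀ j ∈ S i, x j = true) ∧ (∀ j ∈ T i, x j = false)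
  let c (x : Fin n → Bool) : ℕ := ∑ i, if y x i then 1 else 0
  let G (m : ℕ) : Bool := decide (∃ z : Fin s → Bool, (∑ i, if z i then 1 else 0) = m ∧ g z = true)
  let lab : AnchorIndex s → Bool := Sum.elim (fun a => a.2) fun b => xor (G (s - b.1)) b.2.1
  have hc : ∀ x, c x ≤ s := fun x => by
    refine (Finset.sum_le_card_nsmul _ _ 1 fun i _ => ?_).trans (by simp)
    split_ifs <;> simp
  have hG : ∀ x, G (c x) = f x := fun x => by
    have hcx : (∑ i, if decide (y x i) = true then 1 else 0) = c x := by
      simp [c]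
    rw [hf, Bool.eq_iff_iff, decide_eq_true_iff]
    constructor
    · rintro ⟨z, hz, hgz⟩
      exact (hg z _ (hz.trans hcx.symm)).symm.trans hgz
    · exact fun h => ⟨_, hcx, h⟩
  obtain ⟨P, N, hPN, hcard⟩ := isKNNRep_of_family f (anchorFamily S T i₀ η ε)
    (anchorFamily_injective hne i₀ hη hε hη2 (by linarith)) lab (k := 2 * s + 1) (by omega)
    (fun x => nearestIndices (y x) (s - c x) (x i₀))
    (fun x => card_nearestIndices (Nat.sub_le _ _) _ _ (by convert Nat.add_sub_cancel' (hc x)))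
    (fun x a ha b hb => anchorFamily_separated hST hne i₀ hη hη1 hε hη'.le hε'.le x ha hb)
    (fun x => by
      rw [sum_nearestIndices (Nat.sub_le _ _) (y x) (x i₀) _ 0 0
        (fun i => by simp [lab, boolSign])
        (fun r => by cases h : G (s - r) <;> simp [lab, boolSign, h])]
      have hsub : s - (s - c x) = c x := Nat.sub_sub_self (hc x)
      cases h : f x <;> simp [lab, boolSign, hsub, hG, h])
  refine ⟨P, N, hPN, hcard.trans_le ?_⟩
  simp
  omega
end

section
/- Let f : {0,1}^n → {0,1} (n ≥ 1) be computed by a DNF with m ≥ 1 terms, where each term is a nonempty conjunction of literals over distinct variables. Then f has a nearest neighbor (NN) representation with at most m + 1 anchors in ℝ^n; moreover the anchors can be chosen with all coordinates in the set {−1/2, 0, 1/2, 1, 3/2} (one negative anchor (1/2, …, 1/2) and one positive anchor per term). Consequently, every Boolean function computed by a CNF with m nonempty clauses also has an NN representation with at most m + 1 anchors, with all anchor coordinates in {−1/2, 0, 1/2, 1, 3/2}. -/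
open scoped Classical

/-- A nearest neighbor (NN) representation of a Boolean function `f`. -/
def IsNNRep {n : ℕ} (f : (Fin n → Bool) → Bool) (P N : Finset (Fin n → ℝ)) : Prop :=
  P.Nonempty ∧ N.Nonempty ∧ Disjoint P N ∧
    ∀ x : Fin n → Bool,
      (f x = true ↔ ∃ p ∈ P, ∀ q ∈ N, sqDist (bv x) p < sqDist (bv x) q) ∧
      (f x = false ↔ ∃ q ∈ N, ∀ p ∈ P, sqDist (bv x) q < sqDist (bv x) p)

/-- The positive anchor of the term requiring the variables in `S` to be `1` and those in `T` to be
`0`: the pivot `k` gets the satisfying value itself, the other variables of the term a value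
overshooting it by `1/2`, and all remaining variables the value `1/2`. -/
noncomputable def termAnchor {n : ℕ} (S T : Finset (Fin n)) (k : Fin n) : Fin n → ℝ := fun j =>
  if j = k then (if j ∈ S then 1 else 0)
  else if j ∈ S then 3 / 2 else if j ∈ T then -(1 / 2) else 1 / 2

theorem termAnchor_mem {n : ℕ} (S T : Finset (Fin n)) (k j : Fin n) :
    termAnchor S T k j ∈ ({-(1/2), 0, 1/2, 1, 3/2} : Set ℝ) := by
  unfold termAnchor
  split_ifs <;> simp

theorem termAnchor_ne_center {n : ℕ} (S T : Finset (Fin n)) (k : Fin n) :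
    termAnchor S T k ≠ fun _ => (1 / 2 : ℝ) := by
  intro h
  have hk := congrFun h k
  simp only [termAnchor, if_true] at hk
  split_ifs at hk <;> norm_num at hk

theorem sqDist_termAnchor_lt {n : ℕ} {S T : Finset (Fin n)} (hST : Disjoint S T) {k : Fin n}
    (hk : k ∈ S ∪ T) {x : Fin n → Bool} (hS : ∀ j ∈ S, x j = true)
    (hT : ∀ j ∈ T, x j = false) :
    sqDist (bv x) (termAnchor S T k) < sqDist (bv x) fun _ => 1 / 2 := by
  unfold sqDist
  apply Finset.sum_lt_sum
  · intro j _
    have hj : j ∈ S → j ∉ T := fun h => Finset.disjoint_left.mp hST h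
    by_cases h1 : j = k
    · subst h1
      rcases Finset.mem_union.mp hk with h | h
      · norm_num [bv, termAnchor, h, hS j h]
      · have h' : j ∉ S := fun h' => hj h' h
        norm_num [bv, termAnchor, h', hT j h]
    · by_cases h2 : j ∈ S
      · norm_num [bv, termAnchor, h1, h2, hS j h2]
      · by_cases h3 : j ∈ T
        · norm_num [bv, termAnchor, h1, h2, h3, hT j h3]
        · simp [termAnchor, h1, h2, h3]
  · refine ⟨k, Finset.mem_univ k, ?_⟩
    rcases Finset.mem_union.mp hk with h | h
    · norm_num [bv, termAnchor, h, hS k h]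
    · have h' : k ∉ S := fun h' => Finset.disjoint_left.mp hST h' h
      norm_num [bv, termAnchor, h', hT k h]

theorem lt_sqDist_termAnchor {n : ℕ} {S T : Finset (Fin n)} (hST : Disjoint S T) {k : Fin n}
    {x : Fin n → Bool}
    (hx : ¬ ((∀ j ∈ S, x j = true) ∧ ∀ j ∈ T, x j = false)) :
    sqDist (bv x) (fun _ => 1 / 2) < sqDist (bv x) (termAnchor S T k) := by
  obtain ⟨l, hl⟩ : ∃ l, (l ∈ S ∧ x l = false) ∨ (l ∉ S ∧ l ∈ T ∧ x l = true) := by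
    by_contra! hcon
    refine hx ⟨fun j hj => by simpa using (hcon j).1 hj, fun j hj => ?_⟩
    simpa using (hcon j).2 (fun h => Finset.disjoint_left.mp hST h hj) hj
  have hterm : ∀ j, (bv x j - 1 / 2) ^ 2
      + ((if j = k then -(1 / 4) else 0) + if j = l then 1 else 0)
      ≤ (bv x j - termAnchor S T k j) ^ 2 := by
    intro j
    by_cases h2 : j = l
    · subst h2
      rcases hl with ⟨ha, hb⟩ | ⟨ha, hb, hc⟩
      · by_cases h1 : j = k
        · subst h1
          norm_num [bv, termAnchor, ha, hb]
        · norm_num [bv, termAnchor, h1, ha, hb]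
      · by_cases h1 : j = k
        · subst h1
          norm_num [bv, termAnchor, ha, hc]
        · norm_num [bv, termAnchor, h1, ha, hb, hc]
    · unfold bv termAnchor
      split_ifs <;> norm_num
  have hsum := Finset.sum_le_sum fun j (_ : j ∈ Finset.univ) => hterm j
  rw [Finset.sum_add_distrib, Finset.sum_add_distrib] at hsum
  simp only [Finset.sum_ite_eq', Finset.mem_univ, if_true] at hsum
  unfold sqDist
  linarith

theorem IsNNRep.swap {n : ℕ} {f : (Fin n → Bool) → Bool} {P N : Finset (Fin n → ℝ)}
    (h : IsNNRep (fun x => !f x) P N) : IsNNRep f N P := by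
  obtain ⟨hP, hN, hd, hx⟩ := h
  refine ⟨hN, hP, hd.symm, fun x => ?_⟩
  simpa [and_comm] using hx x

/-- A DNF with nonempty terms is represented by one positive anchor per term and the center of the
cube as the only negative anchor. -/
theorem exists_isNNRep_of_dnf {n m : ℕ} (hm : 1 ≤ m) {S T : Fin m → Finset (Fin n)}
    (hST : ∀ i, Disjoint (S i) (T i)) (hne : ∀ i, (S i ∪ T i).Nonempty)
    {f : (Fin n → Bool) → Bool}
    (hf : ∀ x, f x = true ↔ ∃ i, (∀ j ∈ S i, x j = true) ∧ ∀ j ∈ T i, x j = false) :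
    ∃ P : Finset (Fin n → ℝ), IsNNRep f P {fun _ => 1 / 2} ∧ P.card ≤ m ∧
      ∀ p ∈ P ∪ {fun _ => 1 / 2}, ∀ i, p i ∈ ({-(1/2), 0, 1/2, 1, 3/2} : Set ℝ) := by
  choose k hk using hne
  refine ⟨Finset.univ.image fun i => termAnchor (S i) (T i) (k i), ⟨?_, by simp, ?_, fun x => ?_⟩,
    Finset.card_image_le.trans (by simp), ?_⟩
  · exact ⟨_, Finset.mem_image_of_mem _ (Finset.mem_univ ⟨0, hm⟩)⟩
  · rw [Finset.disjoint_singleton_right, Finset.mem_image]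
    rintro ⟨i, -, hi⟩
    exact termAnchor_ne_center _ _ _ hi
  · have hlt : ∀ i, ((∀ j ∈ S i, x j = true) ∧ ∀ j ∈ T i, x j = false) ↔
        sqDist (bv x) (termAnchor (S i) (T i) (k i)) < sqDist (bv x) fun _ => 1 / 2 := fun i =>
      ⟨fun h => sqDist_termAnchor_lt (hST i) (hk i) h.1 h.2, fun h => by
        by_contra hcon
        exact lt_asymm h (lt_sqDist_termAnchor (hST i) hcon)⟩
    constructor
    · simp only [hf, hlt, Finset.mem_image, Finset.mem_univ, true_and, Finset.mem_singleton,
        forall_eq, exists_exists_eq_and]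
    · rw [← Bool.not_eq_true, hf]
      simp only [not_exists, Finset.mem_image, Finset.mem_univ, true_and,
        Finset.mem_singleton, exists_eq_left, forall_exists_index, forall_apply_eq_imp_iff]
      exact forall_congr' fun i => ⟨lt_sqDist_termAnchor (hST i), fun h hcon =>
        lt_asymm h ((hlt i).mp hcon)⟩
  · intro p hp j
    rcases Finset.mem_union.mp hp with hp | hp
    · obtain ⟨i, -, rfl⟩ := Finset.mem_image.mp hp
      exact termAnchor_mem _ _ _ _
    · rw [Finset.mem_singleton.mp hp]
      simp

/-- every DNF with `m` nonempty terms (term `i` requires the variables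
in `S i` to be `1` and those in `T i` to be `0`) has an NN representation with at most
`m + 1` anchors whose coordinates lie in `{-1/2, 0, 1/2, 1, 3/2}`, with the single
negative anchor `(1/2, …, 1/2)` and at most one positive anchor per term; and
consequently every CNF with `m` nonempty clauses has an NN representation with at
most `m + 1` anchors with coordinates in the same set. -/
theorem statement_15 :
    (∀ (n m : ℕ), 1 ≤ n → 1 ≤ m →
      ∀ S T : Fin m → Finset (Fin n), (∀ i, Disjoint (S i) (T i)) →
        (∀ i, (S i ∪ T i).Nonempty) →
        ∀ f : (Fin n → Bool) → Bool,
          (∀ x, f x = true ↔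
            ∃ i : Fin m, (∀ j ∈ S i, x j = true) ∧ (∀ j ∈ T i, x j = false)) →
          ∃ P N : Finset (Fin n → ℝ),
            IsNNRep f P N ∧ P.card + N.card ≤ m + 1 ∧
            N = {fun _ => (1 / 2 : ℝ)} ∧ P.card ≤ m ∧
            ∀ p ∈ P ∪ N, ∀ i, p i ∈ ({-(1/2), 0, 1/2, 1, 3/2} : Set ℝ)) ∧
    (∀ (n m : ℕ), 1 ≤ n → 1 ≤ m →
      ∀ S T : Fin m → Finset (Fin n), (∀ i, Disjoint (S i) (T i)) →
        (∀ i, (S i ∪ T i).Nonempty) →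
        ∀ f : (Fin n → Bool) → Bool,
          (∀ x, f x = true ↔
            ∀ i : Fin m, (∃ j ∈ S i, x j = true) ∨ (∃ j ∈ T i, x j = false)) →
          ∃ P N : Finset (Fin n → ℝ),
            IsNNRep f P N ∧ P.card + N.card ≤ m + 1 ∧
            ∀ p ∈ P ∪ N, ∀ i, p i ∈ ({-(1/2), 0, 1/2, 1, 3/2} : Set ℝ)) := by
  refine ⟨fun n m _ hm S T hST hne f hf => ?_, fun n m _ hm S T hST hne f hf => ?_⟩
  · obtain ⟨P, hrep, hcard, hmem⟩ := exists_isNNRep_of_dnf hm hST hne hf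
    exact ⟨P, _, hrep, by simpa using hcard, rfl, hcard, hmem⟩
  · have hneg : ∀ x, (!f x) = true ↔
        ∃ i, (∀ j ∈ T i, x j = true) ∧ ∀ j ∈ S i, x j = false := by
      intro x
      rw [Bool.not_eq_true', ← Bool.not_eq_true, hf]
      push Not
      simp [and_comm]
    obtain ⟨P, hrep, hcard, hmem⟩ := exists_isNNRep_of_dnf hm (fun i => (hST i).symm)
      (fun i => by rw [Finset.union_comm]; exact hne i) hneg
    refine ⟨_, P, hrep.swap, ?_, fun p hp => hmem p (by rwa [Finset.union_comm])⟩
    rw [Finset.card_singleton]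
    omega
end

section
/- For every n ≥ 1, the disjointness function DISJ : {0,1}^n × {0,1}^n → {0,1}, defined by DISJ(x, y) = 1 if and only if Σ_{i=1}^n x_i y_i = 0, has a Hamming nearest neighbor (HNN) representation with 3n anchors in {0,1}^{2n}: one may take the positive anchors to be the 2n standard basis vectors e_1, …, e_{2n} of {0,1}^{2n}, and the negative anchors to be the n vectors (e_i, e_i) for 1 ≤ i ≤ n, where (e_i, e_i) denotes the concatenation of the i-th standard basis vector of {0,1}^n with itself. -/
open scoped Classical

/-- The disjointness function on `{0,1}^n × {0,1}^n`, viewed on `{0,1}^{2n}`: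
`DISJ(x, y) = 1` iff `Σ_i x_i y_i = 0`. -/
def DISJ (n : ℕ) (z : Fin (n + n) → Bool) : Bool :=
  decide ((∑ i : Fin n,
    (if z (Fin.castAdd n i) = true ∧ z (Fin.natAdd n i) = true then 1 else 0 : ℕ)) = 0)

/-- The Hamming distance from `x` to the indicator vector of `S`, in terms of the weight of `x`,
the size of `S` and their overlap. -/
lemma hammingDist_indicator {ι : Type*} [Fintype ι] [DecidableEq ι] (x : ι → Bool)
    (S : Finset ι) :
    hammingDist x (fun i => decide (i ∈ S)) + 2 * ∑ i ∈ S, (x i).toNat =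
      ∑ i, (x i).toNat + S.card := by
  have hS : S.card = ∑ i, if i ∈ S then 1 else 0 := by simp
  have hx : ∑ i ∈ S, (x i).toNat = ∑ i, if i ∈ S then (x i).toNat else 0 := by simp
  rw [hammingDist, Finset.card_filter, hS, hx, Finset.mul_sum, ← Finset.sum_add_distrib,
    ← Finset.sum_add_distrib]
  refine Finset.sum_congr rfl fun i _ => ?_
  by_cases h : i ∈ S <;> cases x i <;> simp [h]

lemma hammingDist_single {ι : Type*} [Fintype ι] [DecidableEq ι] (x : ι → Bool) (j : ι) :
    hammingDist x (fun i => decide (i = j)) + 2 * (x j).toNat = ∑ i, (x i).toNat + 1 := by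
  simpa using hammingDist_indicator x {j}

lemma hammingDist_pair {ι : Type*} [Fintype ι] [DecidableEq ι] (x : ι → Bool) {a b : ι}
    (hab : a ≠ b) :
    hammingDist x (fun i => decide (i = a ∨ i = b)) + 2 * ((x a).toNat + (x b).toNat) =
      ∑ i, (x i).toNat + 2 := by
  have h := hammingDist_indicator x {a, b}
  rw [Finset.sum_pair hab, Finset.card_pair hab] at h
  simpa only [Finset.mem_insert, Finset.mem_singleton] using h

lemma castAdd_ne_natAdd {n : ℕ} (i j : Fin n) : Fin.castAdd n i ≠ Fin.natAdd n j := by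
  intro h
  have := congrArg Fin.val h
  simp only [Fin.val_castAdd, Fin.val_natAdd] at this
  omega

lemma DISJ_eq_true_iff {n : ℕ} (x : Fin (n + n) → Bool) :
    DISJ n x = true ↔
      ∀ i : Fin n, ¬(x (Fin.castAdd n i) = true ∧ x (Fin.natAdd n i) = true) := by
  simp [DISJ]

/-- On disjoint inputs some basis vector is strictly closer than all vectors `(e_i, e_i)`. -/
lemma exists_single_closer {n : ℕ} (hn : 1 ≤ n) {x : Fin (n + n) → Bool}
    (hx : DISJ n x = true) :
    ∃ j : Fin (n + n), ∀ k : Fin n,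
      hammingDist x (fun i => decide (i = j)) <
        hammingDist x (fun i => decide (i = Fin.castAdd n k ∨ i = Fin.natAdd n k)) := by
  rw [DISJ_eq_true_iff] at hx
  by_cases h : ∃ j, x j = true
  · obtain ⟨j, hj⟩ := h
    refine ⟨j, fun k => ?_⟩
    have h1 := hammingDist_single x j
    have h2 := hammingDist_pair x (castAdd_ne_natAdd k k)
    have h3 : (x (Fin.castAdd n k)).toNat + (x (Fin.natAdd n k)).toNat ≤ 1 := by
      have := hx k
      cases ha : x (Fin.castAdd n k) <;> cases hb : x (Fin.natAdd n k) <;> simp_all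
    rw [hj, Bool.toNat_true] at h1
    omega
  · push Not at h
    refine ⟨⟨0, by omega⟩, fun k => ?_⟩
    have h1 := hammingDist_single x ⟨0, by omega⟩
    have h2 := hammingDist_pair x (castAdd_ne_natAdd k k)
    simp only [Bool.eq_false_iff.mpr (h _), Bool.toNat_false] at h1 h2
    omega

/-- On intersecting inputs some vector `(e_i, e_i)` is strictly closer than all basis vectors. -/
lemma exists_pair_closer {n : ℕ} {x : Fin (n + n) → Bool} (hx : DISJ n x = false) :
    ∃ k : Fin n, ∀ j : Fin (n + n),
      hammingDist x (fun i => decide (i = Fin.castAdd n k ∨ i = Fin.natAdd n k)) <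
        hammingDist x (fun i => decide (i = j)) := by
  rw [← Bool.not_eq_true, DISJ_eq_true_iff] at hx
  push Not at hx
  obtain ⟨k, ha, hb⟩ := hx
  refine ⟨k, fun j => ?_⟩
  have h1 := hammingDist_single x j
  have h2 := hammingDist_pair x (castAdd_ne_natAdd k k)
  have h3 := Bool.toNat_le (x j)
  rw [ha, hb, Bool.toNat_true] at h2
  omega

lemma single_injective (ι : Type*) [DecidableEq ι] :
    Function.Injective fun j : ι => fun i : ι => decide (i = j) := by
  intro a b h
  simpa using congrFun h a

lemma pair_injective (n : ℕ) :
    Function.Injective fun j : Fin n => fun i : Fin (n + n) =>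
      decide (i = Fin.castAdd n j ∨ i = Fin.natAdd n j) := by
  intro a b h
  have ha := congrFun h (Fin.castAdd n a)
  simp only [decide_true, castAdd_ne_natAdd, or_false, Fin.castAdd_inj] at ha
  simpa using ha

lemma single_ne_pair {n : ℕ} (j : Fin (n + n)) (k : Fin n) :
    (fun i => decide (i = j)) ≠
      fun i : Fin (n + n) => decide (i = Fin.castAdd n k ∨ i = Fin.natAdd n k) := by
  intro h
  have ha := congrFun h (Fin.castAdd n k)
  have hb := congrFun h (Fin.natAdd n k)
  simp only [true_or, or_true, decide_true, decide_eq_true_eq] at ha hb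
  exact castAdd_ne_natAdd k k (ha.trans hb.symm)

/-- `DISJ` has an HNN representation with `3n` anchors: the `2n`
standard basis vectors as positive anchors, and the `n` vectors `(e_i, e_i)` as
negative anchors. -/
theorem statement_16 (n : ℕ) (hn : 1 ≤ n) :
    ∃ P N : Finset (Fin (n + n) → Bool),
      P = Finset.univ.image (fun j : Fin (n + n) => (fun i => decide (i = j))) ∧
      N = Finset.univ.image (fun j : Fin n =>
            (fun i : Fin (n + n) => decide (i = Fin.castAdd n j ∨ i = Fin.natAdd n j))) ∧
      IsHNNRep (DISJ n) P N ∧ P.card + N.card = 3 * n := by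
  refine ⟨_, _, rfl, rfl, ⟨?_, ?_, ?_, fun x => ?_⟩, ?_⟩
  · exact ⟨_, Finset.mem_image_of_mem _ (Finset.mem_univ ⟨0, by omega⟩)⟩
  · exact ⟨_, Finset.mem_image_of_mem _ (Finset.mem_univ ⟨0, by omega⟩)⟩
  · rw [Finset.disjoint_left]
    simp only [Finset.mem_image, Finset.mem_univ, true_and]
    rintro _ ⟨j, rfl⟩ ⟨k, hk⟩
    exact single_ne_pair j k hk.symm
  · simp only [Finset.mem_image, Finset.mem_univ, true_and, exists_exists_eq_and,
      forall_exists_index, forall_apply_eq_imp_iff]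
    refine ⟨⟨exists_single_closer hn, ?_⟩, ⟨exists_pair_closer, ?_⟩⟩
    · rintro ⟨j, hj⟩
      by_contra h
      obtain ⟨k, hk⟩ := exists_pair_closer (Bool.eq_false_iff.mpr h)
      exact lt_asymm (hj k) (hk j)
    · rintro ⟨k, hk⟩
      by_contra h
      obtain ⟨j, hj⟩ := exists_single_closer hn (Bool.not_eq_false _ ▸ h)
      exact lt_asymm (hj k) (hk j)
  · rw [Finset.card_image_of_injective _ (single_injective _),
      Finset.card_image_of_injective _ (pair_injective n), Finset.card_univ, Finset.card_univ,
      Fintype.card_fin, Fintype.card_fin]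
    omega
end

section
/- Let n ≥ 2 be even and let MAJ : {0,1}^n → {0,1} be the majority function, MAJ(x) = 1 if and only if x_1 + … + x_n ≥ n/2. Then every Hamming nearest neighbor (HNN) representation (P, N) of MAJ satisfies |P| + |N| ≥ n/2 + 2. -/
/-- The majority function: `MAJ(x) = 1` iff `x_1 + ⋯ + x_n ≥ n/2`. -/
def MAJ (n : ℕ) (x : Fin n → Bool) : Bool :=
  decide (n ≤ 2 * ∑ i, if x i then 1 else 0)

/-- If `p` beats every anchor of `B` at `x`, while some anchor of `B` beats all of `A ∋ p` after
the `i`-th coordinate of `x` is set to `p i`, then `x` and `p` already agree at `i`. -/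
lemma eq_of_nearest_of_update {n : ℕ} {A B : Finset (Fin n → Bool)} {x p : Fin n → Bool}
    (hp : p ∈ A) (hx : ∀ q ∈ B, hammingDist x p < hammingDist x q) (i : Fin n)
    (hy : ∃ q ∈ B, ∀ p' ∈ A,
      hammingDist (Function.update x i (p i)) q < hammingDist (Function.update x i (p i)) p') :
    x i = p i := by
  by_contra hne
  obtain ⟨q, hq, hqA⟩ := hy
  have hcloser : hammingDist (Function.update x i (p i)) p < hammingDist x p := by
    refine Finset.card_lt_card (Finset.ssubset_iff_of_subset ?_ |>.2 ⟨i, by simpa using hne, by simp⟩)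
    intro j hj
    by_cases hji : j = i
    · subst hji
      simpa using hne
    · simpa [hji] using hj
  have hstep : hammingDist x (Function.update x i (p i)) ≤ 1 := by
    refine (Finset.card_le_card (t := {i}) fun j hj => ?_).trans (by simp)
    by_contra hji
    simp_all
  have htri := hammingDist_triangle x (Function.update x i (p i)) q
  have h₁ := hx q hq
  have h₂ := hqA p hp
  omega

/-- Few vectors, each taking the value `b` somewhere, all take the value `b` on a common `k`-set. -/
lemma exists_card_eq_forall_exists_mem {n k : ℕ} (hk : k ≤ n) {S : Finset (Fin n → Bool)}
    (hS : S.card ≤ k) (b : Bool) (h : ∀ p ∈ S, ∃ i, p i = b) :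
    ∃ T : Finset (Fin n), T.card = k ∧ ∀ p ∈ S, ∃ i ∈ T, p i = b := by
  choose g hg using fun p : S => h p p.2
  obtain ⟨T, hT, hcard⟩ := Finset.exists_superset_card_eq
    ((Finset.card_image_le (s := S.attach) (f := g)).trans (by simpa using hS)) (by simpa using hk)
  exact ⟨T, hcard, fun p hp =>
    ⟨g ⟨p, hp⟩, hT (Finset.mem_image_of_mem g (S.mem_attach _)), hg ⟨p, hp⟩⟩⟩

lemma MAJ_indicator {n : ℕ} (T : Finset (Fin n)) :
    MAJ n (fun i => decide (i ∈ T)) = decide (n ≤ 2 * T.card) := by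
  simp [MAJ]

lemma update_indicator_false {n : ℕ} (T : Finset (Fin n)) (i : Fin n) :
    Function.update (fun j => decide (j ∈ T)) i false = fun j => decide (j ∈ T.erase i) := by
  ext j
  by_cases h : j = i <;> simp [h]

lemma update_indicator_true {n : ℕ} (T : Finset (Fin n)) (i : Fin n) :
    Function.update (fun j => decide (j ∈ T)) i true = fun j => decide (j ∈ insert i T) := by
  ext j
  by_cases h : j = i <;> simp [h]

lemma hammingDist_indicator_false {n : ℕ} (T : Finset (Fin n)) :
    hammingDist (fun i => decide (i ∈ T)) (fun _ => false) = T.card := by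
  simp [hammingDist]

lemma hammingDist_indicator_true {n : ℕ} (T : Finset (Fin n)) :
    hammingDist (fun i => decide (i ∈ T)) (fun _ => true) = Tᶜ.card := by
  simp [hammingDist, Finset.compl_eq_univ_sdiff, Finset.sdiff_eq_filter]

/-- If the zero vector is a negative anchor, at least `m + 1` positive anchors are needed. -/
lemma card_pos_of_zero_mem {m : ℕ} (hm : 1 ≤ m) {P N : Finset (Fin (m + m) → Bool)}
    (hrep : IsHNNRep (MAJ (m + m)) P N) (h0 : (fun _ => false) ∈ N) : m + 1 ≤ P.card := by
  obtain ⟨-, -, -, hf⟩ := hrep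
  by_contra! hlt
  obtain ⟨T, hT, hTP⟩ := exists_card_eq_forall_exists_mem (k := m) (by omega)
    (S := P.erase fun _ => true) ((Finset.card_erase_le).trans (by omega)) false
    (fun p hp => by
      by_contra! h
      exact (Finset.mem_erase.1 hp).1 (funext fun i => by simpa using h i))
  obtain ⟨p, hp, hpN⟩ := (hf fun i => decide (i ∈ T)).1.1 (by
    rw [MAJ_indicator, decide_eq_true_iff]; omega)
  have hp1 : p ≠ fun _ => true := by
    rintro rfl
    have := hpN _ h0
    rw [hammingDist_indicator_false, hammingDist_indicator_true, Finset.card_compl,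
      Fintype.card_fin] at this
    omega
  obtain ⟨i, hiT, hpi⟩ := hTP p (Finset.mem_erase.2 ⟨hp1, hp⟩)
  have := eq_of_nearest_of_update hp hpN i ((hf _).2.1 (by
    rw [hpi, update_indicator_false, MAJ_indicator, decide_eq_false_iff_not,
      Finset.card_erase_of_mem hiT]
    omega))
  simp [hiT, hpi] at this

/-- If the zero vector is not a negative anchor, at least `m + 2` negative anchors are needed. -/
lemma card_neg_of_zero_notMem {m : ℕ} (hm : 1 ≤ m) {P N : Finset (Fin (m + m) → Bool)}
    (hrep : IsHNNRep (MAJ (m + m)) P N) (h0 : (fun _ => false) ∉ N) : m + 2 ≤ N.card := by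
  obtain ⟨-, -, -, hf⟩ := hrep
  by_contra! hlt
  obtain ⟨T, hT, hTN⟩ := exists_card_eq_forall_exists_mem (k := m + 1) (by omega)
    (S := N) (by omega) true
    (fun q hq => by
      by_contra! h
      exact h0 ((funext fun i => by simpa using h i : q = fun _ => false) ▸ hq))
  have hTc : Tᶜ.card = m - 1 := by
    rw [Finset.card_compl, Fintype.card_fin]; omega
  obtain ⟨q, hq, hqP⟩ := (hf fun i => decide (i ∈ Tᶜ)).2.1 (by
    rw [MAJ_indicator, decide_eq_false_iff_not]; omega)
  obtain ⟨i, hiT, hqi⟩ := hTN q hq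
  have hiTc : i ∉ Tᶜ := by simpa using hiT
  have := eq_of_nearest_of_update hq hqP i ((hf _).1.1 (by
    rw [hqi, update_indicator_true, MAJ_indicator, decide_eq_true_iff,
      Finset.card_insert_of_notMem hiTc]
    omega))
  simp [hiT, hqi] at this

/-- for even `n ≥ 2`, every HNN representation of the majority
function on `n` inputs has at least `n/2 + 2` anchors. -/
theorem statement_18 {n : ℕ} (hn : 2 ≤ n) (heven : Even n)
    (P N : Finset (Fin n → Bool)) (hrep : IsHNNRep (MAJ n) P N) :
    n / 2 + 2 ≤ P.card + N.card := by
  obtain ⟨m, rfl⟩ := heven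
  have hN := hrep.2.1.card_pos
  by_cases h0 : (fun _ => false) ∈ N
  · have := card_pos_of_zero_mem (by omega) hrep h0
    omega
  · have := card_neg_of_zero_notMem (by omega) hrep h0
    omega
end

section
/- Let f : {0,1}^n → {0,1} (n ≥ 1) have a Hamming nearest neighbor (HNN) representation with m anchors. Then there exist an integer s ≤ 2m(n+1), threshold functions g_1, …, g_s of the form g_j(x) = 1 iff ⟨w_j, x⟩ ≥ θ_j with weight vectors w_j ∈ {−1, 1}^n and integer thresholds θ_j, and integers u_1, …, u_s and θ, such that for every x ∈ {0,1}^n: f(x) = 1 if and only if Σ_{j=1}^s u_j · g_j(x) ≥ θ. That is, f is computed by a depth-two circuit consisting of a linear threshold gate applied to at most 2m(n+1) majority-type gates. -/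
/-- The gate weights of the satisfied conditions `d + k ≤ n` add up to a geometric sum. -/
theorem sum_fin_ite_add_le (m n d : ℕ) :
    ∑ k : Fin (n + 1), (m : ℤ) ^ (k : ℕ) * (if d + k ≤ n then 1 else 0) =
      ∑ k ∈ Finset.range (n + 1 - d), (m : ℤ) ^ k := by
  rw [Fin.sum_univ_eq_sum_range
    (fun k => (m : ℤ) ^ k * (if d + k ≤ n then 1 else 0)) (n + 1)]
  simp only [mul_ite, mul_one, mul_zero]
  rw [← Finset.sum_filter]
  refine Finset.sum_congr ?_ fun _ _ => rfl
  ext k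
  simp only [Finset.mem_filter, Finset.mem_range]
  omega

/-- If some element of `P` is strictly `d`-closer than all elements of `N`, then its geometric sum
outweighs those of all of `N`. -/
theorem sum_geom_lt_sum_geom {α : Type*} {P N : Finset α} {m n : ℕ} {d : α → ℕ}
    (hN : N.card ≤ m) (hd : ∀ a, d a ≤ n) {p : α} (hp : p ∈ P) (hlt : ∀ q ∈ N, d p < d q) :
    ∑ q ∈ N, ∑ k ∈ Finset.range (n + 1 - d q), (m : ℤ) ^ k <
      ∑ p ∈ P, ∑ k ∈ Finset.range (n + 1 - d p), (m : ℤ) ^ k := by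
  have hpow : ∀ k : ℕ, (0 : ℤ) ≤ (m : ℤ) ^ k := fun k => by positivity
  calc ∑ q ∈ N, ∑ k ∈ Finset.range (n + 1 - d q), (m : ℤ) ^ k
      ≤ N.card • ∑ k ∈ Finset.range (n - d p), (m : ℤ) ^ k := by
        refine Finset.sum_le_card_nsmul _ _ _ fun q hq => ?_
        refine Finset.sum_le_sum_of_subset_of_nonneg ?_ fun k _ _ => hpow k
        have := hlt q hq
        exact Finset.range_mono (by omega)
    _ ≤ m * ∑ k ∈ Finset.range (n - d p), (m : ℤ) ^ k := by
        rw [nsmul_eq_mul]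
        exact mul_le_mul_of_nonneg_right (by exact_mod_cast hN)
          (Finset.sum_nonneg fun k _ => hpow k)
    _ < ∑ k ∈ Finset.range (n + 1 - d p), (m : ℤ) ^ k := by
        rw [Nat.sub_add_comm (hd p), geom_sum_succ]
        exact lt_add_one _
    _ ≤ ∑ p ∈ P, ∑ k ∈ Finset.range (n + 1 - d p), (m : ℤ) ^ k :=
        Finset.single_le_sum
          (f := fun p => ∑ k ∈ Finset.range (n + 1 - d p), (m : ℤ) ^ k)
          (fun a _ => Finset.sum_nonneg fun k _ => hpow k) hp

/-- The Hamming distance to `a` is an affine function of `x` with linear coefficients `±1`. -/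
theorem sum_sign_mul_bz {n : ℕ} (a x : Fin n → Bool) :
    ∑ i, (2 * bz (a i) - 1) * bz (x i) = ∑ i, bz (a i) - (hammingDist x a : ℤ) := by
  rw [hammingDist, Finset.card_filter, Nat.cast_sum, ← Finset.sum_sub_distrib]
  refine Finset.sum_congr rfl fun i _ => ?_
  cases a i <;> cases x i <;> simp [bz]

/-- every function with an HNN representation with `m` anchors is
computed by a linear threshold gate applied to at most `2m(n+1)` majority-type
gates, i.e. threshold gates with weight vectors in `{-1, 1}^n`. -/
theorem statement_19 {n : ℕ} (hn : 1 ≤ n) (f : (Fin n → Bool) → Bool)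
    (P N : Finset (Fin n → Bool)) (m : ℕ) (hm : P.card + N.card = m)
    (hrep : IsHNNRep f P N) :
    ∃ (s : ℕ) (w : Fin s → Fin n → ℤ) (θ : Fin s → ℤ) (u : Fin s → ℤ) (Θ : ℤ),
      s ≤ 2 * m * (n + 1) ∧
      (∀ j i, w j i = -1 ∨ w j i = 1) ∧
      ∀ x : Fin n → Bool,
        (f x = true ↔
          Θ ≤ ∑ j, u j * (if θ j ≤ ∑ i, w j i * bz (x i) then 1 else 0)) := by
  obtain ⟨-, -, -, hf⟩ := hrep
  let ι := (P ⊕ N) × Fin (n + 1)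
  let anchor : P ⊕ N → Fin n → Bool := Sum.elim Subtype.val Subtype.val
  let sign : P ⊕ N → ℤ := Sum.elim (fun _ => 1) (fun _ => -1)
  have hcard : Fintype.card ι = m * (n + 1) := by simp [ι, hm]
  let e : Fin (Fintype.card ι) ≃ ι := (Fintype.equivFin ι).symm
  refine ⟨Fintype.card ι, fun j i => 2 * bz (anchor (e j).1 i) - 1,
    fun j => ∑ i, bz (anchor (e j).1 i) - n + ((e j).2 : ℕ),
    fun j => sign (e j).1 * (m : ℤ) ^ ((e j).2 : ℕ), 1, ?_, ?_, fun x => ?_⟩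
  · rw [hcard, mul_assoc]
    exact Nat.le_mul_of_pos_left _ two_pos
  · intro j i
    have hsign : ∀ b : Bool, 2 * bz b - 1 = -1 ∨ 2 * bz b - 1 = 1 := by decide
    exact hsign _
  · have hgate : ∀ (a : Fin n → Bool) (k : ℕ),
        ∑ i, bz (a i) - n + k ≤ ∑ i, (2 * bz (a i) - 1) * bz (x i) ↔
          hammingDist x a + k ≤ n := by
      intro a k
      rw [sum_sign_mul_bz]
      omega
    have hsum : ∑ j, sign (e j).1 * (m : ℤ) ^ ((e j).2 : ℕ) *
        (if ∑ i, bz (anchor (e j).1 i) - n + ((e j).2 : ℕ) ≤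
          ∑ i, (2 * bz (anchor (e j).1 i) - 1) * bz (x i) then 1 else 0) =
        ∑ p ∈ P, ∑ k ∈ Finset.range (n + 1 - hammingDist x p), (m : ℤ) ^ k -
          ∑ q ∈ N, ∑ k ∈ Finset.range (n + 1 - hammingDist x q), (m : ℤ) ^ k := by
      simp only [hgate]
      rw [e.sum_comp fun y : ι => sign y.1 * (m : ℤ) ^ (y.2 : ℕ) *
        (if hammingDist x (anchor y.1) + y.2 ≤ n then 1 else 0), Fintype.sum_prod_type]
      simp only [mul_assoc, ← Finset.mul_sum, sum_fin_ite_add_le]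
      rw [Fintype.sum_sum_type, ← Finset.sum_coe_sort P, ← Finset.sum_coe_sort N]
      simp [sign, anchor, sub_eq_add_neg]
    rw [hsum]
    have hd : ∀ a, hammingDist x a ≤ n := fun a => by
      simpa using hammingDist_le_card_fintype (x := x) (y := a)
    constructor
    · intro h
      obtain ⟨p, hp, hlt⟩ := (hf x).1.1 h
      have := sum_geom_lt_sum_geom (m := m) (by omega) hd hp hlt
      omega
    · intro h
      by_contra hx
      obtain ⟨q, hq, hlt⟩ := (hf x).2.1 (by simpa using hx)
      have := sum_geom_lt_sum_geom (m := m) (by omega) hd hq hlt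
      omega
end
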